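/- There exist absolute constants C ≥ 1 and c ≥ 1 such that for every odd prime p, every real K ≥ 1, every finite set A ⊆ F_p with |A+A| ≤ K|A|, and every λ ∈ F_p with λ ≠ 0, one has r_{AA}(λ) ≤ C (log p)^c ( K² |A|² / p + K^{5/4} |A|^{23/24} ). -/

import Mathlib

open Finset Pointwise

/-- `r_{AA}(λ) = #{(a₁,a₂) ∈ A×A : a₁a₂ = λ}`. -/
def mulRep (p : ℕ) (A : Finset (ZMod p)) (lam : ZMod p) : ℕ :=
  ((A ×ˢ A).filter fun t => t.1 * t.2 = lam).card

section Poly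
open Polynomial

/-- restriction to a line -/
noncomputable def rst {k : Type*} [Field k] (μ u v : k) : MvPolynomial (Fin 3) k →ₐ[k] k[X] :=
  MvPolynomial.aeval ![C (u - μ * v) + C (μ ^ 2) * X, C v - C μ * X, X]

theorem pd_comm {k : Type*} [Field k] (i j : Fin 3) (Q : MvPolynomial (Fin 3) k) :
    MvPolynomial.pderiv i (MvPolynomial.pderiv j Q) =
      MvPolynomial.pderiv j (MvPolynomial.pderiv i Q) := by
  have h : ⁅MvPolynomial.pderiv (R := k) i, MvPolynomial.pderiv (R := k) j⁆ = 0 := by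
    apply MvPolynomial.derivation_ext
    intro l
    rw [Derivation.commutator_apply]
    simp [MvPolynomial.pderiv_X, Pi.single_apply, apply_ite]
  have h2 := congrArg (fun D => D Q) h
  simp only [Derivation.commutator_apply, Derivation.zero_apply] at h2
  exact sub_eq_zero.mp h2

theorem rst_deriv {k : Type*} [Field k] (μ u v : k) (Q : MvPolynomial (Fin 3) k) :
    derivative (rst μ u v Q) = C (μ ^ 2) * rst μ u v (MvPolynomial.pderiv 0 Q)
      - C μ * rst μ u v (MvPolynomial.pderiv 1 Q) + rst μ u v (MvPolynomial.pderiv 2 Q) := by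
  induction Q using MvPolynomial.induction_on with
  | C a => simp [rst]
  | add p q hp hq => simp only [map_add, hp, hq]; ring
  | mul_X q i hq =>
    simp only [map_mul, derivative_mul, hq, MvPolynomial.pderiv_mul, map_add]
    have : derivative (rst μ u v (MvPolynomial.X i)) =
       C (μ ^ 2) * rst μ u v (MvPolynomial.pderiv 0 (MvPolynomial.X i))
      - C μ * rst μ u v (MvPolynomial.pderiv 1 (MvPolynomial.X i)) + rst μ u v (MvPolynomial.pderiv 2 (MvPolynomial.X i)) := by
      fin_cases i <;> simp [rst, MvPolynomial.pderiv_X, -map_pow, derivative_C]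
    rw [this]; ring

theorem rst_natDegree {k : Type*} [Field k] (μ u v : k) (Q : MvPolynomial (Fin 3) k) (D : ℕ)
    (h : Q.totalDegree ≤ D) : (rst μ u v Q).natDegree ≤ D := by
  have := MvPolynomial.aeval_natDegree_le (m := D) (n := 1) Q h
    ![C (u - μ * v) + C (μ ^ 2) * X, C v - C μ * X, X] (by
      intro i
      fin_cases i
      · simp; compute_degree
      · simp; compute_degree
      · simp)
  simpa [rst] using this

theorem rst_cross {k : Type*} [Field k] (μ u v μ' u' v' t : k) (h1 : v - v' = (μ - μ') * t)
    (h2 : u' - u + μ * v' - μ' * v = 0) (Q : MvPolynomial (Fin 3) k) :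
    (rst μ u v Q).eval t = (rst μ' u' v' Q).eval t := by
  induction Q using MvPolynomial.induction_on with
  | C a => simp [rst]
  | add p q hp hq => simp only [map_add, eval_add, hp, hq]
  | mul_X q i hq =>
    simp only [map_mul, eval_mul, hq]
    congr 1
    fin_cases i
    · simp [rst]; linear_combination -h2 - (μ+μ') * h1
    · simp [rst]; linear_combination h1
    · simp [rst]

theorem td_pderiv {k : Type*} [Field k] (i : Fin 3) (Q : MvPolynomial (Fin 3) k) :
    (MvPolynomial.pderiv i Q).totalDegree ≤ Q.totalDegree - 1 := by
  unfold MvPolynomial.totalDegree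
  apply Finset.sup_le
  intro m hm
  rw [MvPolynomial.mem_support_iff, MvPolynomial.coeff_pderiv] at hm
  have h1 : m + Finsupp.single i 1 ∈ Q.support := by
    rw [MvPolynomial.mem_support_iff]; exact left_ne_zero_of_mul hm
  have h2 := MvPolynomial.le_totalDegree h1
  rw [Finsupp.sum_add_index' (by simp) (by simp)] at h2
  rw [Finsupp.sum_single_index (by simp)] at h2
  unfold MvPolynomial.totalDegree at h2
  omega

theorem deriv_zero_const {k : Type*} [Field k] (p : ℕ) [CharP k p] (U : k[X]) (hU : U.natDegree < p)
    (h : derivative U = 0) : ∃ c, U = C c := by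
  refine ⟨U.coeff 0, ?_⟩
  ext n
  rcases n with _ | n
  · simp
  · rw [coeff_C_succ]
    by_contra hne
    have h1 := congrArg (fun q => q.coeff n) h
    simp only [coeff_derivative, coeff_zero] at h1
    have h2 : ((n + 1 : ℕ) : k) = 0 := by
      push_cast
      exact (mul_eq_zero.mp h1).resolve_left hne
    rw [CharP.cast_eq_zero_iff k p] at h2
    have := Nat.le_of_dvd (by omega) h2
    have := le_natDegree_of_ne_zero hne
    omega

theorem wronsk_const {k : Type*} [Field k] (p : ℕ) [CharP k p] (U V : k[X]) (hU : U.natDegree < p)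
    (hV : V.natDegree < p) (hV0 : V ≠ 0)
    (h : derivative U * V = U * derivative V) : ∃ c, U = C c * V := by
  classical
  have hg : gcd U V ≠ 0 := by
    intro h0; exact hV0 ((gcd_eq_zero_iff _ _).mp h0).2
  obtain ⟨U1, hU1⟩ := gcd_dvd_left U V
  obtain ⟨V1, hV1⟩ := gcd_dvd_right U V
  set g := gcd U V with hgdef
  have hcop : IsCoprime U1 V1 := by
    have h1 : IsCoprime (EuclideanDomain.gcd U V) 1 := isCoprime_one_right
    rw [← gcd_isUnit_iff]
    have : gcd (g * U1) (g * V1) = normalize g * gcd U1 V1 := gcd_mul_left _ _ _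
    rw [← hU1, ← hV1, ← hgdef] at this
    have hn : normalize g = g := normalize_gcd U V
    rw [hn] at this
    have h2 : gcd U1 V1 = 1 := by
      apply mul_left_cancel₀ hg
      rw [← this, mul_one]
    rw [h2]; exact isUnit_one
  have hw : U1.wronskian V1 = 0 := by
    have : g ^ 2 * U1.wronskian V1 = 0 := by
      rw [Polynomial.wronskian]
      rw [hU1, hV1] at h
      simp only [derivative_mul] at h
      linear_combination -h
    exact (mul_eq_zero.mp this).resolve_left (pow_ne_zero _ hg)
  obtain ⟨a1, b1⟩ := (hcop.wronskian_eq_zero_iff).mp hw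
  have hV10 : V1 ≠ 0 := by rintro rfl; simp at hV1; exact hV0 hV1
  have dU1 : U1.natDegree < p := by
    by_cases h0 : U1 = 0
    · subst h0; simp; omega
    · rw [hU1, natDegree_mul hg h0] at hU; omega
  have dV1 : V1.natDegree < p := by
    rw [hV1, natDegree_mul hg hV10] at hV; omega
  obtain ⟨a, ha⟩ := deriv_zero_const p U1 dU1 a1
  obtain ⟨b, hb⟩ := deriv_zero_const p V1 dV1 b1
  have hb0 : b ≠ 0 := by rintro rfl; simp at hb; exact hV10 hb
  refine ⟨a / b, ?_⟩
  rw [hU1, hV1, ha, hb]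
  have : C (a / b) * C b = C a := by rw [← C_mul]; congr 1; field_simp
  linear_combination -g * this

end Poly

section Poly2
open Polynomial

theorem exists_vanish {k ι : Type*} [Field k] (L : Finset ι) (μ u v : ι → k) (e : ℕ)
    (hn : L.card * (3 * e + 1) < (e + 1) ^ 3) :
    ∃ P : MvPolynomial (Fin 3) k, P ≠ 0 ∧ P.totalDegree ≤ 3 * e ∧
      ∀ i ∈ L, rst (μ i) (u i) (v i) P = 0 := by
  classical
  let mo : (Fin 3 → Fin (e + 1)) → (Fin 3 →₀ ℕ) := fun g =>
    Finsupp.equivFunOnFinite.symm (fun i => (g i : ℕ))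
  have hmo : Function.Injective mo := by
    intro g g' h
    have := Finsupp.equivFunOnFinite.symm.injective h
    ext i
    exact congrFun this i
  let b : (Fin 3 → Fin (e + 1)) → MvPolynomial (Fin 3) k := fun g => MvPolynomial.monomial (mo g) 1
  have hb : LinearIndependent k b := by
    have := (MvPolynomial.basisMonomials (Fin 3) k).linearIndependent.comp mo hmo
    have h2 : (MvPolynomial.basisMonomials (Fin 3) k) ∘ mo = b := by
      ext g
      simp [b]
    rw [h2] at this
    exact this
  let Λ := Fintype.linearCombination k b
  have hinj : Function.Injective Λ := by
    exact hb.fintypeLinearCombination_injective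
  have hdeg : ∀ f, (Λ f).totalDegree ≤ 3 * e := by
    intro f
    rw [Fintype.linearCombination_apply]
    apply MvPolynomial.totalDegree_finsetSum_le
    intro g _
    refine (MvPolynomial.totalDegree_smul_le _ _).trans ?_
    refine (MvPolynomial.totalDegree_monomial_le _ _).trans ?_
    rw [Finsupp.sum_fintype _ _ (by simp)]
    simp only [Fin.sum_univ_three, id]
    have : ∀ i, mo g i ≤ e := fun i => by
      change ((g i : Fin (e+1)) : ℕ) ≤ e
      have := (g i).2; omega
    have h0 := this 0
    have h1 := this 1
    have h2 := this 2
    omega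
  let Ψ : ((Fin 3 → Fin (e + 1)) → k) →ₗ[k] (L × Fin (3 * e + 1) → k) :=
    LinearMap.pi fun x => (Polynomial.lcoeff k (x.2 : ℕ)).comp
      ((rst (μ x.1) (u x.1) (v x.1)).toLinearMap.comp Λ)
  have hker : LinearMap.ker Ψ ≠ ⊥ := by
    apply LinearMap.ker_ne_bot_of_finrank_lt
    rw [Module.finrank_fintype_fun_eq_card, Module.finrank_fintype_fun_eq_card]
    simpa using hn
  obtain ⟨f, hf, hf0⟩ := (Submodule.ne_bot_iff _).mp hker
  refine ⟨Λ f, ?_, hdeg f, ?_⟩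
  · intro h; exact hf0 (hinj (by rw [h, map_zero]))
  · intro i hi
    have hd := rst_natDegree (μ i) (u i) (v i) (Λ f) _ (hdeg f)
    ext n
    rw [coeff_zero]
    by_cases hnn : n < 3 * e + 1
    · have := congrFun (LinearMap.mem_ker.mp hf) (⟨i, hi⟩, ⟨n, hnn⟩)
      simpa [Ψ] using this
    · apply coeff_eq_zero_of_natDegree_lt; omega

theorem exists_nonsing {k ι : Type*} [Field k] (p : ℕ) [CharP k p] (L : Finset ι) (hL : L.Nonempty) (μ u v : ι → k) (e : ℕ)
    (hn : L.card * (3 * e + 1) < (e + 1) ^ 3) (hp : 3 * e < p) :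
    ∃ P : MvPolynomial (Fin 3) k, P.totalDegree ≤ 3 * e ∧
      (∀ i ∈ L, rst (μ i) (u i) (v i) P = 0) ∧
      ∃ i ∈ L, ∃ j, rst (μ i) (u i) (v i) (MvPolynomial.pderiv j P) ≠ 0 := by
  classical
  have hex : ∃ d : ℕ, ∃ P : MvPolynomial (Fin 3) k, P ≠ 0 ∧ P.totalDegree = d ∧ 
      ∀ i ∈ L, rst (μ i) (u i) (v i) P = 0 := by
    obtain ⟨P, h1, h2, h3⟩ := exists_vanish L μ u v e hn
    exact ⟨_, P, h1, rfl, h3⟩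
  have hle : Nat.find hex ≤ 3 * e := by
    obtain ⟨P, h1, h2, h3⟩ := exists_vanish L μ u v e hn
    exact (Nat.find_min' hex ⟨P, h1, rfl, h3⟩).trans h2
  obtain ⟨P, h1, h2, h3⟩ := Nat.find_spec hex
  refine ⟨P, by omega, h3, ?_⟩
  by_contra hcon
  push Not at hcon
  have hz : ∀ j, MvPolynomial.pderiv j P = 0 := by
    intro j
    by_contra hj
    have h4 := Nat.find_min' hex ⟨_, hj, rfl, fun i hi => hcon i hi j⟩
    have h5 := td_pderiv j P
    have h6 : P.totalDegree = 0 := by omega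
    rw [MvPolynomial.totalDegree_eq_zero_iff_eq_C] at h6
    apply hj
    rw [h6]; simp
  have hP : P = MvPolynomial.C (P.coeff 0) := by
    ext m
    rw [MvPolynomial.coeff_C]
    split_ifs with hm
    · rw [hm]
    · by_contra hc
      have : ∃ i, m i ≠ 0 := by
        by_contra h; push Not at h; apply hm; ext i; simp [h i]
      obtain ⟨i, hi⟩ := this
      have h4 := congrArg (MvPolynomial.coeff (m - Finsupp.single i 1)) (hz i)
      rw [MvPolynomial.coeff_pderiv] at h4
      have h5 : m - Finsupp.single i 1 + Finsupp.single i 1 = m := by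
        apply tsub_add_cancel_of_le
        rw [Finsupp.single_le_iff]; omega
      rw [h5] at h4
      simp only [MvPolynomial.coeff_zero, mul_eq_zero, hc, false_or] at h4
      have h6 : ((m i : ℕ) : k) = 0 := by
        have : m i = (m - Finsupp.single i 1 : Fin 3 →₀ ℕ) i + 1 := by
          simp; omega
        rw [this]; push_cast; exact h4
      rw [CharP.cast_eq_zero_iff k p] at h6
      have h7 := Nat.le_of_dvd (by omega) h6
      have h8 := MvPolynomial.le_totalDegree (MvPolynomial.mem_support_iff.mpr hc)
      rw [Finsupp.sum_fintype _ _ (by simp)] at h8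
      have h9 := Finset.single_le_sum (f := fun j => m j) (fun j _ => Nat.zero_le _) (Finset.mem_univ i)
      omega
  obtain ⟨i, hi⟩ := hL
  have h4 := h3 i hi
  rw [hP] at h4
  simp [rst] at h4
  apply h1
  rw [hP, h4]; simp

end Poly2

section Poly3
open Polynomial

/-- second order form along `v(m)` -/
def hq {R : Type*} [CommRing R] (m xx xy xz yy yz zz : R) : R :=
  m ^ 4 * xx - 2 * m ^ 3 * xy + m ^ 2 * (2 * xz + yy) - 2 * m * yz + zz

/-- The form `K`. -/
def kform {R : Type*} [CommRing R] (m f s xx xy xz yy yz zz : R) : R :=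
  f ^ 4 * hq m xx xy xz yy yz zz
  - 2 * f ^ 3 * s * (2 * m * (m ^ 2 * xx - m * xy + xz) - (m ^ 2 * xy - m * yy + yz))
  + f ^ 2 * s ^ 2 * (4 * m ^ 2 * xx - 4 * m * xy + yy + 2 * (m ^ 2 * xx - m * xy + xz))
  - 2 * f * s ^ 3 * (2 * m * xx - xy) + s ^ 4 * xx

theorem kform_cross {R : Type*} [CommRing R] (m m' f s xx xy xz yy yz zz : R)
    (hs : s = (m - m') * f) : kform m f s xx xy xz yy yz zz = f ^ 4 * hq m' xx xy xz yy yz zz := by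
  subst hs; unfold kform hq; ring

/-- `dv m x y z` is the derivative along `v(m)` given partials. -/
def dv {R : Type*} [CommRing R] (m x y z : R) : R := m ^ 2 * x - m * y + z

/-- derivative of kform -/
def kform' {R : Type*} [CommRing R] (m f s xx xy xz yy yz zz f' s' xx' xy' xz' yy' yz' zz' : R) : R :=
  4 * f ^ 3 * f' * hq m xx xy xz yy yz zz + f ^ 4 * hq m xx' xy' xz' yy' yz' zz'
  - 2 * (3 * f ^ 2 * f' * s + f ^ 3 * s') * (2 * m * (m ^ 2 * xx - m * xy + xz) - (m ^ 2 * xy - m * yy + yz))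
  - 2 * f ^ 3 * s * (2 * m * (m ^ 2 * xx' - m * xy' + xz') - (m ^ 2 * xy' - m * yy' + yz'))
  + (2 * f * f' * s ^ 2 + 2 * f ^ 2 * s * s') * (4 * m ^ 2 * xx - 4 * m * xy + yy + 2 * (m ^ 2 * xx - m * xy + xz))
  + f ^ 2 * s ^ 2 * (4 * m ^ 2 * xx' - 4 * m * xy' + yy' + 2 * (m ^ 2 * xx' - m * xy' + xz'))
  - 2 * (f' * s ^ 3 + 3 * f * s ^ 2 * s') * (2 * m * xx - xy)
  - 2 * f * s ^ 3 * (2 * m * xx' - xy') + 4 * s ^ 3 * s' * xx + s ^ 4 * xx'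

theorem kform_deriv {k : Type*} [Field k] (m : k) (f s xx xy xz yy yz zz : k[X]) :
    derivative (kform (C m) f s xx xy xz yy yz zz) = 
    kform' (C m) f s xx xy xz yy yz zz (derivative f) (derivative s) (derivative xx)
     (derivative xy) (derivative xz) (derivative yy) (derivative yz) (derivative zz) := by
  unfold kform kform' hq
  simp only [derivative_mul, derivative_add, derivative_sub, derivative_pow, derivative_C,
    derivative_ofNat, Nat.cast_ofNat]
  have h2 : (C (2:k) : k[X]) = 2 := rfl
  have h3 : (C (3:k) : k[X]) = 3 := rfl
  have h4 : (C (4:k) : k[X]) = 4 := rfl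
  simp only [h2, h3, h4]
  ring

theorem kform_eval {k : Type*} [Field k] (t m : k) (f s xx xy xz yy yz zz : k[X]) :
    eval t (kform (C m) f s xx xy xz yy yz zz) =
      kform m (eval t f) (eval t s) (eval t xx) (eval t xy) (eval t xz) (eval t yy) (eval t yz) (eval t zz) := by
  unfold kform hq
  simp

theorem kform'_eval {k : Type*} [Field k] (t m : k) (f s xx xy xz yy yz zz f' s' xx' xy' xz' yy' yz' zz' : k[X]) :
    eval t (kform' (C m) f s xx xy xz yy yz zz f' s' xx' xy' xz' yy' yz' zz') =
      kform' m (eval t f) (eval t s) (eval t xx) (eval t xy) (eval t xz) (eval t yy) (eval t yz) (eval t zz)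
      (eval t f') (eval t s') (eval t xx') (eval t xy') (eval t xz') (eval t yy') (eval t yz') (eval t zz') := by
  unfold kform' hq
  simp

/-- The form `W`. -/
def wform {R : Type*} [CommRing R] (f s f' s' f'' s'' : R) : R :=
  (f'' * s - f * s'') * s - 2 * s' * (f' * s - f * s')

theorem key_identity {R : Type*} [CommRing R]
  (m n l xx xy xz yy yz zz xxx xxy xxz xyy xyz xzz yyy yyz yzz zzz : R)
  (hb : hq m xx xy xz yy yz zz = 0) (ha : hq n xx xy xz yy yz zz = 0)
  (hbb : m ^ 2 * hq m xxx xxy xxz xyy xyz xzz - m * hq m xxy xyy xyz yyy yyz yzz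
    + hq m xxz xyz xzz yyz yzz zzz = 0) :
  (n - m) * kform' n l ((n - m) * l) xx xy xz yy yz zz (dv n xx xy xz)
    (2 * n * dv n xx xy xz - dv n xy yy yz) (dv n xxx xxy xxz) (dv n xxy xyy xyz) (dv n xxz xyz xzz)
     (dv n xyy yyy yyz) (dv n xyz yyz yzz) (dv n xzz yzz zzz) =
  (n - m) * l ^ 2 * wform l ((m - n) * l) (dv m xx xy xz) (2 * m * dv m xx xy xz - dv m xy yy yz)
    (hq m xxx xxy xxz xyy xyz xzz) (2 * m * hq m xxx xxy xxz xyy xyz xzz - hq m xxy xyy xyz yyy yyz yzz) := by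
  have hb' := hb
  have ha' := ha
  have hbb' := hbb
  unfold hq at hb' ha' hbb'
  unfold kform' wform dv hq
  linear_combination (n-m) * (4 * l ^3 * (n^2*xx - n*xy + xz) * hb' + l ^ 4 * hbb') - 2 * l ^ 3 * (2 * m * (m^2*xx - m*xy+xz) - (m^2*xy-m*yy+yz)) * (ha' - hb')

end Poly3

section Poly4
open Polynomial

theorem ev_deriv {k : Type*} [Field k] (μ u v t : k) (Q : MvPolynomial (Fin 3) k) :
    eval t (derivative (rst μ u v Q)) = dv μ (eval t (rst μ u v (MvPolynomial.pderiv 0 Q)))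
      (eval t (rst μ u v (MvPolynomial.pderiv 1 Q))) (eval t (rst μ u v (MvPolynomial.pderiv 2 Q))) := by
  rw [rst_deriv]; simp [dv]

theorem ev_deriv2 {k : Type*} [Field k] (μ u v t : k) (Q : MvPolynomial (Fin 3) k) :
    eval t (derivative (derivative (rst μ u v Q))) = 
    hq μ (eval t (rst μ u v (MvPolynomial.pderiv 0 (MvPolynomial.pderiv 0 Q))))
     (eval t (rst μ u v (MvPolynomial.pderiv 0 (MvPolynomial.pderiv 1 Q))))
     (eval t (rst μ u v (MvPolynomial.pderiv 0 (MvPolynomial.pderiv 2 Q))))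
     (eval t (rst μ u v (MvPolynomial.pderiv 1 (MvPolynomial.pderiv 1 Q))))
     (eval t (rst μ u v (MvPolynomial.pderiv 1 (MvPolynomial.pderiv 2 Q))))
     (eval t (rst μ u v (MvPolynomial.pderiv 2 (MvPolynomial.pderiv 2 Q)))) := by
  rw [rst_deriv]
  simp only [derivative_add, derivative_sub, derivative_C_mul, eval_add, eval_sub, eval_mul, eval_C, ev_deriv]
  rw [pd_comm 1 0 Q, pd_comm 2 0 Q, pd_comm 2 1 Q]
  unfold hq dv; ring

theorem ev_deriv3 {k : Type*} [Field k] (μ u v t : k) (Q : MvPolynomial (Fin 3) k) :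
    eval t (derivative (derivative (derivative (rst μ u v Q)))) = 
    μ ^ 2 * eval t (derivative (derivative (rst μ u v (MvPolynomial.pderiv 0 Q))))
    - μ * eval t (derivative (derivative (rst μ u v (MvPolynomial.pderiv 1 Q))))
    + eval t (derivative (derivative (rst μ u v (MvPolynomial.pderiv 2 Q)))) := by
  rw [rst_deriv]
  simp only [derivative_add, derivative_sub, derivative_C_mul, eval_add, eval_sub, eval_mul, eval_C]

/-- `φ` -/
noncomputable def phiP {k : Type*} [Field k] (μ u v : k) (P : MvPolynomial (Fin 3) k) : k[X] :=
  rst μ u v (MvPolynomial.pderiv 0 P)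
/-- `ψ` -/
noncomputable def psiP {k : Type*} [Field k] (μ u v : k) (P : MvPolynomial (Fin 3) k) : k[X] :=
  C (2 * μ) * rst μ u v (MvPolynomial.pderiv 0 P) - rst μ u v (MvPolynomial.pderiv 1 P)
/-- `K` -/
noncomputable def KP {k : Type*} [Field k] (μ u v : k) (P : MvPolynomial (Fin 3) k) : k[X] :=
  kform (C μ) (phiP μ u v P) (psiP μ u v P)
     (rst μ u v (MvPolynomial.pderiv 0 (MvPolynomial.pderiv 0 P)))
     (rst μ u v (MvPolynomial.pderiv 0 (MvPolynomial.pderiv 1 P)))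
     (rst μ u v (MvPolynomial.pderiv 0 (MvPolynomial.pderiv 2 P)))
     (rst μ u v (MvPolynomial.pderiv 1 (MvPolynomial.pderiv 1 P)))
     (rst μ u v (MvPolynomial.pderiv 1 (MvPolynomial.pderiv 2 P)))
     (rst μ u v (MvPolynomial.pderiv 2 (MvPolynomial.pderiv 2 P)))
/-- `W` -/
noncomputable def WP {k : Type*} [Field k] (μ u v : k) (P : MvPolynomial (Fin 3) k) : k[X] :=
  wform (phiP μ u v P) (psiP μ u v P) (derivative (phiP μ u v P)) (derivative (psiP μ u v P))
    (derivative (derivative (phiP μ u v P))) (derivative (derivative (psiP μ u v P)))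

theorem cross_vals {k : Type*} [Field k] (μ u v μ' u' v' t : k) (h1 : v - v' = (μ - μ') * t)
    (h2 : u' - u + μ * v' - μ' * v = 0) (hμ : μ ≠ μ') (P : MvPolynomial (Fin 3) k)
    (hP : rst μ u v P = 0) (hP' : rst μ' u' v' P = 0) :
    eval t (rst μ u v (MvPolynomial.pderiv 1 P)) = (μ + μ') * eval t (phiP μ u v P) ∧
    eval t (rst μ u v (MvPolynomial.pderiv 2 P)) = μ * μ' * eval t (phiP μ u v P) ∧
    eval t (psiP μ u v P) = (μ - μ') * eval t (phiP μ u v P) := by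
  have a := ev_deriv μ u v t P
  have b := ev_deriv μ' u' v' t P
  rw [hP] at a
  rw [hP'] at b
  simp only [← rst_cross μ u v μ' u' v' t h1 h2] at b
  simp only [derivative_zero, eval_zero, dv] at a b
  have hne : μ - μ' ≠ 0 := sub_ne_zero.mpr hμ
  have e1 : eval t (rst μ u v (MvPolynomial.pderiv 1 P)) = (μ + μ') * eval t (phiP μ u v P) := by
    apply mul_left_cancel₀ hne
    unfold phiP
    linear_combination a - b
  refine ⟨e1, ?_, ?_⟩
  · unfold phiP at *
    rw [e1] at a
    linear_combination -a
  · unfold psiP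
    simp only [eval_sub, eval_mul, eval_C, e1]
    unfold phiP
    ring

theorem K_cross {k : Type*} [Field k] (μ u v μ' u' v' t : k) (h1 : v - v' = (μ - μ') * t)
    (h2 : u' - u + μ * v' - μ' * v = 0) (hμ : μ ≠ μ') (P : MvPolynomial (Fin 3) k)
    (hP : rst μ u v P = 0) (hP' : rst μ' u' v' P = 0) : eval t (KP μ u v P) = 0 := by
  obtain ⟨-, -, h3⟩ := cross_vals μ u v μ' u' v' t h1 h2 hμ P hP hP'
  unfold KP
  rw [kform_eval, kform_cross μ μ' _ _ _ _ _ _ _ _ h3]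
  have b := ev_deriv2 μ' u' v' t P
  rw [hP'] at b
  simp only [← rst_cross μ u v μ' u' v' t h1 h2] at b
  rw [← b]; simp

theorem W_cross {k : Type*} [Field k] (μ u v μ' u' v' t : k) (h1 : v - v' = (μ - μ') * t)
    (h2 : u' - u + μ * v' - μ' * v = 0) (hμ : μ ≠ μ') (P : MvPolynomial (Fin 3) k)
    (hP : rst μ u v P = 0) (hP' : rst μ' u' v' P = 0) (hK : KP μ' u' v' P = 0) :
    eval t (WP μ u v P) = 0 := by
  obtain ⟨c1, c2, c3⟩ := cross_vals μ u v μ' u' v' t h1 h2 hμ P hP hP'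
  obtain ⟨-, -, c3'⟩ := cross_vals μ' u' v' μ u v t (by linear_combination -h1)
    (by linear_combination -h2) hμ.symm P hP' hP
  have hW : eval t (WP μ u v P) = wform (eval t (phiP μ u v P)) (eval t (psiP μ u v P))
    (eval t (derivative (phiP μ u v P))) (eval t (derivative (psiP μ u v P)))
    (eval t (derivative (derivative (phiP μ u v P)))) (eval t (derivative (derivative (psiP μ u v P)))) := by
    unfold WP wform; simp
  rw [hW]
  by_cases h0 : eval t (phiP μ u v P) = 0
  · rw [c3, h0]; unfold wform; ring
  have hKd : eval t (derivative (KP μ' u' v' P)) = 0 := by rw [hK]; simp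
  unfold KP at hKd
  rw [kform_deriv, kform'_eval, c3'] at hKd
  have d1 : ∀ (m a b : k), eval t (derivative (psiP m a b P)) = 
     2 * m * eval t (derivative (rst m a b (MvPolynomial.pderiv 0 P))) - 
      eval t (derivative (rst m a b (MvPolynomial.pderiv 1 P))) := by
    intro m a b; unfold psiP
    simp only [derivative_sub, derivative_C_mul, eval_sub, eval_mul, eval_C]
  have d2 : ∀ (m a b : k), eval t (derivative (derivative (psiP m a b P))) = 
     2 * m * eval t (derivative (derivative (rst m a b (MvPolynomial.pderiv 0 P)))) - 
      eval t (derivative (derivative (rst m a b (MvPolynomial.pderiv 1 P)))) := by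
    intro m a b; unfold psiP
    simp only [derivative_sub, derivative_C_mul, eval_sub, eval_mul, eval_C]
  have b2 := ev_deriv2 μ u v t P
  have a2 := ev_deriv2 μ' u' v' t P
  have b3 := ev_deriv3 μ u v t P
  rw [hP] at b2 b3
  rw [hP'] at a2
  rw [c3, d1, d2]
  rw [d1] at hKd
  unfold phiP at hKd h0 ⊢
  simp only [ev_deriv, ev_deriv2] at hKd b2 a2 b3 ⊢
  simp only [← rst_cross μ u v μ' u' v' t h1 h2] at hKd a2 b2 b3 ⊢
  simp only [derivative_zero, eval_zero] at a2 b2 b3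
  simp only [pd_comm 1 0, pd_comm 2 0, pd_comm 2 1] at hKd a2 b2 b3 ⊢
  have key := key_identity μ μ' _ _ _ _ _ _ _ _ _ _ _ _ _ _ _ _ b2.symm a2.symm b3.symm (l := eval t (rst μ u v (MvPolynomial.pderiv 0 P)))
  rw [hKd, mul_zero] at key
  have hne : μ' - μ ≠ 0 := sub_ne_zero.mpr hμ.symm
  rcases mul_eq_zero.mp key.symm with h | h
  · exact absurd h (mul_ne_zero hne (pow_ne_zero _ h0))
  · exact h

end Poly4

section Poly5
open Polynomial

theorem nd_mul {k : Type*} [Field k] {f g : k[X]} {a b c : ℕ} (hf : f.natDegree ≤ a) (hg : g.natDegree ≤ b)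
    (h : a + b ≤ c) : (f * g).natDegree ≤ c := (natDegree_mul_le_of_le hf hg).trans h

theorem nd_add {k : Type*} [Field k] {f g : k[X]} {c : ℕ} (hf : f.natDegree ≤ c) (hg : g.natDegree ≤ c) :
    (f + g).natDegree ≤ c := natDegree_add_le_of_degree_le hf hg

theorem nd_sub {k : Type*} [Field k] {f g : k[X]} {c : ℕ} (hf : f.natDegree ≤ c) (hg : g.natDegree ≤ c) :
    (f - g).natDegree ≤ c := by
  rw [sub_eq_add_neg]; exact nd_add hf (by rwa [natDegree_neg])

theorem nd_pow {k : Type*} [Field k] {f : k[X]} {c : ℕ} (n : ℕ) (hf : f.natDegree ≤ c) :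
    (f ^ n).natDegree ≤ n * c := natDegree_pow_le_of_le n hf

theorem nd_C {k : Type*} [Field k] (a : k) (n : ℕ) {f : k[X]} {c : ℕ} (hf : f.natDegree ≤ c) : 
    (C a ^ n * f).natDegree ≤ c := by
  rw [← C_pow]; exact (natDegree_C_mul_le _ _).trans hf

theorem nd_C' {k : Type*} [Field k] (a : k) {f : k[X]} {c : ℕ} (hf : f.natDegree ≤ c) : 
    (C a * f).natDegree ≤ c := (natDegree_C_mul_le _ _).trans hf

theorem kform_deg {k : Type*} [Field k] (m : k) (f s xx xy xz yy yz zz : k[X]) (D : ℕ)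
    (hf : f.natDegree ≤ D) (hs : s.natDegree ≤ D)
    (hxx : xx.natDegree ≤ D) (hxy : xy.natDegree ≤ D) (hxz : xz.natDegree ≤ D)
    (hyy : yy.natDegree ≤ D) (hyz : yz.natDegree ≤ D) (hzz : zz.natDegree ≤ D) :
    (kform (C m) f s xx xy xz yy yz zz).natDegree ≤ 5 * D := by
  have h : kform (C m) f s xx xy xz yy yz zz = 
    f ^ 4 * (C (m^4) * xx - C (2 * m ^ 3) * xy + C (m ^ 2) * (C 2 * xz + yy) - C (2 * m) * yz + zz)
   - f ^ 3 * (s * (C (4 * m) * (C (m ^ 2) * xx - C m * xy + xz) - C 2 * (C (m ^ 2) * xy - C m * yy + yz)))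
   + f ^ 2 * (s ^ 2 * (C (4 * m ^ 2) * xx - C (4 * m) * xy + yy + C 2 * (C (m ^ 2) * xx - C m * xy + xz)))
   - f * (s ^ 3 * (C (4 * m) * xx - C 2 * xy)) + s ^ 4 * xx := by
    have h2 : (C (2:k) : k[X]) = 2 := rfl
    have h4 : (C (4:k) : k[X]) = 4 := rfl
    unfold kform hq
    simp only [C_mul, C_pow, h2, h4]
    ring
  rw [h]
  have q1 : (C (m^4) * xx - C (2 * m ^ 3) * xy + C (m ^ 2) * (C 2 * xz + yy) - C (2 * m) * yz + zz).natDegree ≤ D := by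
    with_reducible (repeat' first | assumption | apply nd_add | apply nd_sub | apply nd_C')
  have q2 : ((C (4 * m) * (C (m ^ 2) * xx - C m * xy + xz) - C 2 * (C (m ^ 2) * xy - C m * yy + yz))).natDegree ≤ D := by
    with_reducible (repeat' first | assumption | apply nd_add | apply nd_sub | apply nd_C')
  have q3 : ((C (4 * m ^ 2) * xx - C (4 * m) * xy + yy + C 2 * (C (m ^ 2) * xx - C m * xy + xz))).natDegree ≤ D := by
    with_reducible (repeat' first | assumption | apply nd_add | apply nd_sub | apply nd_C')
  have q4 : (C (4 * m) * xx - C 2 * xy).natDegree ≤ D := by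
    with_reducible (repeat' first | assumption | apply nd_add | apply nd_sub | apply nd_C')
  refine nd_add (nd_sub (nd_add (nd_sub ?_ ?_) ?_) ?_) ?_
  · exact nd_mul (nd_pow 4 hf) q1 (by omega)
  · exact nd_mul (nd_pow 3 hf) (nd_mul hs q2 le_rfl) (by omega)
  · exact nd_mul (nd_pow 2 hf) (nd_mul (nd_pow 2 hs) q3 le_rfl) (by omega)
  · exact nd_mul hf (nd_mul (nd_pow 3 hs) q4 le_rfl) (by omega)
  · exact nd_mul (nd_pow 4 hs) hxx (by omega)

theorem rst_nd1 {k : Type*} [Field k] (μ u v : k) (P : MvPolynomial (Fin 3) k) (D : ℕ)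
    (hD : P.totalDegree ≤ D) (i : Fin 3) : (rst μ u v (MvPolynomial.pderiv i P)).natDegree ≤ D := by
  apply rst_natDegree
  have := td_pderiv i P
  omega

theorem rst_nd2 {k : Type*} [Field k] (μ u v : k) (P : MvPolynomial (Fin 3) k) (D : ℕ)
    (hD : P.totalDegree ≤ D) (i j : Fin 3) :
    (rst μ u v (MvPolynomial.pderiv i (MvPolynomial.pderiv j P))).natDegree ≤ D := by
  apply rst_natDegree
  have := td_pderiv j P
  have := td_pderiv i (MvPolynomial.pderiv j P)
  omega

theorem psi_deg {k : Type*} [Field k] (μ u v : k) (P : MvPolynomial (Fin 3) k) (D : ℕ)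
    (hD : P.totalDegree ≤ D) : (psiP μ u v P).natDegree ≤ D := 
  nd_sub (nd_C' _ (rst_nd1 _ _ _ _ _ hD _)) (rst_nd1 _ _ _ _ _ hD _)

theorem KP_deg {k : Type*} [Field k] (μ u v : k) (P : MvPolynomial (Fin 3) k) (D : ℕ)
    (hD : P.totalDegree ≤ D) : (KP μ u v P).natDegree ≤ 5 * D := by
  apply kform_deg
  · exact rst_nd1 _ _ _ _ _ hD _
  · exact psi_deg _ _ _ _ _ hD
  all_goals exact rst_nd2 _ _ _ _ _ hD _ _

theorem nd_der {k : Type*} [Field k] {f : k[X]} {c : ℕ} (hf : f.natDegree ≤ c) : 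
    (derivative f).natDegree ≤ c := (natDegree_derivative_le f).trans (by omega)

theorem WP_deg {k : Type*} [Field k] (μ u v : k) (P : MvPolynomial (Fin 3) k) (D : ℕ)
    (hD : P.totalDegree ≤ D) : (WP μ u v P).natDegree ≤ 3 * D := by
  have h1 : (phiP μ u v P).natDegree ≤ D := rst_nd1 _ _ _ _ _ hD _
  have h2 := psi_deg μ u v P D hD
  have h3 := nd_der h1
  have h4 := nd_der h2
  have h5 := nd_der h3
  have h6 := nd_der h4
  unfold WP wform
  have e : ∀ s' : k[X], (2 : k[X]) * s' = C 2 * s' := fun s' => rfl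
  rw [e]
  refine nd_sub (nd_mul (b := D) (nd_sub (c := 2 * D) (nd_mul h5 h2 (by omega)) (nd_mul h1 h6 (by omega))) h2 (by omega)) ?_
  exact nd_mul (nd_C' _ h4) (nd_sub (c := 2 * D) (nd_mul h3 h2 (by omega)) (nd_mul h1 h4 (by omega))) (by omega)

theorem W_solve {k : Type*} [Field k] (p : ℕ) [CharP k p] (f s : k[X]) (D : ℕ) (hf : f.natDegree ≤ D)
    (hs : s.natDegree ≤ D) (hp : 2 * D + 1 < p) (hs0 : s ≠ 0)
    (hW : wform f s (derivative f) (derivative s) (derivative (derivative f)) (derivative (derivative s)) = 0) :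
    ∃ c e : k, f = (C c * X + C e) * s := by
  have hE : ∃ c, (derivative f * s - f * derivative s) = C c * s ^ 2 := by
    apply wronsk_const p
    · refine lt_of_le_of_lt (nd_sub (c := 2 * D) (nd_mul (nd_der hf) hs (by omega)) (nd_mul hf (nd_der hs) (by omega))) (by omega)
    · exact lt_of_le_of_lt (nd_pow 2 hs) (by omega)
    · exact pow_ne_zero _ hs0
    · unfold wform at hW
      have h2 : (C (2:k) : k[X]) = 2 := rfl
      simp only [derivative_sub, derivative_mul, derivative_pow, Nat.cast_ofNat, h2]
      linear_combination s * hW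
  obtain ⟨c, hc⟩ := hE
  have hF : ∃ e, (f - C c * X * s) = C e * s := by
    apply wronsk_const p
    · refine lt_of_le_of_lt (nd_sub (c := D + 1) (by omega) (nd_mul (a := 1) (b := D) ?_ hs (by omega))) (by omega)
      exact nd_C' _ natDegree_X_le
    · omega
    · exact hs0
    · simp only [derivative_sub, derivative_mul, derivative_C, derivative_X]
      linear_combination hc
  obtain ⟨e, he⟩ := hF
  exact ⟨c, e, by linear_combination he⟩

end Poly5

section Poly6
open Polynomial

theorem low_degree {k ι : Type*} [Field k] [DecidableEq k] [DecidableEq ι] (p : ℕ) [CharP k p] (L : Finset ι) (hL : L.Nonempty)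
    (μ u v : ι → k) (adj : ι → ι → Prop) [DecidableRel adj]
    (hμ : ∀ i j, adj i j → μ i ≠ μ j)
    (huv : ∀ i j, adj i j → u j - u i + μ i * v j - μ j * v i = 0)
    (hinj : ∀ i j j', adj i j → adj i j' → (v i - v j) * (μ i - μ j') = (v i - v j') * (μ i - μ j) → j = j')
    (κ : ℕ) (hκ : ∀ i, ∀ e f : k, (L.filter fun j => adj i j ∧ 1 = e * (v j - v i) + f * (μ j - μ i)).card ≤ κ)
    (e : ℕ) (hn : L.card * (3 * e + 1) < (e + 1) ^ 3) (hp : 6 * e + 1 < p) :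
    ∃ i ∈ L, (L.filter (adj i)).card ≤ 15 * e + κ := by
  classical
  by_contra hcon
  push Not at hcon
  obtain ⟨P, hdeg, hvan, i0, hi0, j0, hns⟩ := exists_nonsing p L hL μ u v e hn (by omega)
  let t : ι → ι → k := fun i j => (v i - v j) / (μ i - μ j)
  have ht : ∀ i j, adj i j → v i - v j = (μ i - μ j) * t i j := by
    intro i j h
    have := sub_ne_zero.mpr (hμ i j h)
    simp only [t]; field_simp
  have htinj : ∀ i (S : Finset ι), (∀ j ∈ S, adj i j) → (S.image (t i)).card = S.card := by
    intro i S hS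
    apply Finset.card_image_of_injOn
    intro j hj j' hj' h
    apply hinj i j j' (hS j hj) (hS j' hj')
    rw [ht i j (hS j hj), ht i j' (hS j' hj'), h]; ring
  have hvanish : ∀ (F : k[X]) i (S : Finset ι), (∀ j ∈ S, adj i j) → (∀ j ∈ S, eval (t i j) F = 0) →
      F.natDegree < S.card → F = 0 := by
    intro F i S hS hF hd
    refine eq_zero_of_natDegree_lt_card_of_eval_eq_zero' F (S.image (t i)) ?_ ?_
    · intro x hx
      obtain ⟨j, hj, rfl⟩ := Finset.mem_image.mp hx
      exact hF j hj
    · rw [htinj i S hS]; exact hd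
  have hK : ∀ i ∈ L, KP (μ i) (u i) (v i) P = 0 := by
    intro i hi
    apply hvanish _ i (L.filter (adj i))
    · intro j hj; exact (Finset.mem_filter.mp hj).2
    · intro j hj
      obtain ⟨hjL, hij⟩ := Finset.mem_filter.mp hj
      exact K_cross _ _ _ _ _ _ _ (ht i j hij) (huv i j hij) (hμ i j hij) P (hvan i hi) (hvan j hjL)
    · have := KP_deg (μ i) (u i) (v i) P _ hdeg
      have := hcon i hi
      omega
  have hW : WP (μ i0) (u i0) (v i0) P = 0 := by
    apply hvanish _ i0 (L.filter (adj i0))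
    · intro j hj; exact (Finset.mem_filter.mp hj).2
    · intro j hj
      obtain ⟨hjL, hij⟩ := Finset.mem_filter.mp hj
      exact W_cross _ _ _ _ _ _ _ (ht i0 j hij) (huv i0 j hij) (hμ i0 j hij) P (hvan i0 hi0) (hvan j hjL) (hK j hjL)
    · have := WP_deg (μ i0) (u i0) (v i0) P _ hdeg
      have := hcon i0 hi0
      omega
  let φ := phiP (μ i0) (u i0) (v i0) P
  let ψ := psiP (μ i0) (u i0) (v i0) P
  let N := L.filter (adj i0)
  have hval : ∀ j ∈ N, _ := fun j hj => by
    obtain ⟨hjL, hij⟩ := Finset.mem_filter.mp hj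
    exact cross_vals _ _ _ _ _ _ _ (ht i0 j hij) (huv i0 j hij) (hμ i0 j hij) P (hvan i0 hi0) (hvan j hjL)
  -- bad neighbours
  have hbad : (N.filter fun j => eval (t i0 j) φ = 0).card ≤ 3 * e := by
    by_contra hb
    push Not at hb
    apply hns
    apply hvanish _ i0 (N.filter fun j => eval (t i0 j) φ = 0)
    · intro j hj; exact (Finset.mem_filter.mp (Finset.mem_filter.mp hj).1).2
    · intro j hj
      obtain ⟨h1, h2⟩ := Finset.mem_filter.mp hj
      obtain ⟨c1, c2, c3⟩ := hval j h1
      simp only [φ] at h2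
      rw [h2, mul_zero] at c1 c2
      fin_cases j0
      · exact h2
      · exact c1
      · exact c2
    · exact lt_of_le_of_lt (rst_nd1 _ _ _ _ _ hdeg _) hb
  have hgood : (N.filter fun j => ¬ eval (t i0 j) φ = 0).card ≤ κ := by
    by_cases hψ : ψ = 0
    · rw [Finset.card_eq_zero.mpr]; · omega
      rw [Finset.filter_eq_empty_iff]
      intro j hj
      obtain ⟨c1, c2, c3⟩ := hval j hj
      simp only [ψ] at hψ
      rw [hψ, eval_zero] at c3
      push Not
      have := sub_ne_zero.mpr (hμ i0 j (Finset.mem_filter.mp hj).2)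
      exact (mul_eq_zero.mp c3.symm).resolve_left this
    · obtain ⟨c, f, hcf⟩ := W_solve p φ ψ (3 * e) (rst_nd1 _ _ _ _ _ hdeg _) (psi_deg _ _ _ _ _ hdeg) (by omega) hψ hW
      refine le_trans (Finset.card_le_card ?_) (hκ i0 (-c) (-f))
      intro j hj
      obtain ⟨h1, h2⟩ := Finset.mem_filter.mp hj
      obtain ⟨hjL, hij⟩ := Finset.mem_filter.mp h1
      obtain ⟨c1, c2, c3⟩ := hval j h1
      refine Finset.mem_filter.mpr ⟨hjL, hij, ?_⟩
      have h3 := congrArg (eval (t i0 j)) hcf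
      simp only [eval_mul, eval_add, eval_C, eval_X] at h3
      simp only [ψ, φ] at h3 h2
      rw [c3] at h3
      have h4 := ht i0 j hij
      apply mul_right_cancel₀ h2
      linear_combination h3 - c * eval (t i0 j) (phiP (μ i0) (u i0) (v i0) P) * h4
  have hsum := Finset.card_filter_add_card_filter_not (s := N) (fun j => eval (t i0 j) φ = 0)
  have := hcon i0 hi0
  change _ < N.card at this
  omega

theorem edge_bound {k ι : Type*} [Field k] [DecidableEq k] [DecidableEq ι] (p : ℕ) [CharP k p] (L : Finset ι)
    (μ u v : ι → k) (adj : ι → ι → Prop) [DecidableRel adj] (hsymm : ∀ i j, adj i j → adj j i)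
    (hμ : ∀ i j, adj i j → μ i ≠ μ j)
    (huv : ∀ i j, adj i j → u j - u i + μ i * v j - μ j * v i = 0)
    (hinj : ∀ i j j', adj i j → adj i j' → (v i - v j) * (μ i - μ j') = (v i - v j') * (μ i - μ j) → j = j')
    (κ : ℕ) (hκ : ∀ i, ∀ e f : k, (L.filter fun j => adj i j ∧ 1 = e * (v j - v i) + f * (μ j - μ i)).card ≤ κ)
    (e : ℕ) (hn : L.card * (3 * e + 1) < (e + 1) ^ 3) (hp : 6 * e + 1 < p) :
    ((L ×ˢ L).filter fun x => adj x.1 x.2).card ≤ 2 * L.card * (15 * e + κ) := by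
  classical
  have H : ∀ n : ℕ, ∀ M ⊆ L, M.card = n → ((M ×ˢ M).filter fun x => adj x.1 x.2).card ≤ 2 * n * (15 * e + κ) := by
    intro n
    induction n with
    | zero => intro M hM h0; rw [Finset.card_eq_zero] at h0; subst h0; simp
    | succ n ih =>
      intro M hM hc
      have hne : M.Nonempty := by rw [← Finset.card_pos]; omega
      have hcl := Finset.card_le_card hM
      obtain ⟨i, hi, hd⟩ := low_degree p M hne μ u v adj hμ huv hinj κ (fun i a b => 
        (Finset.card_le_card (Finset.filter_subset_filter _ hM)).trans (hκ i a b)) e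
        (lt_of_le_of_lt (Nat.mul_le_mul_right _ hcl) hn) hp
      have h1 := ih (M.erase i) ((Finset.erase_subset _ _).trans hM) (by rw [Finset.card_erase_of_mem hi]; omega)
      have hsub : ((M ×ˢ M).filter fun x => adj x.1 x.2) ⊆ 
         (((M.erase i) ×ˢ (M.erase i)).filter fun x => adj x.1 x.2) ∪ 
          ((M.filter (adj i)).image (fun j => (i, j)) ∪ (M.filter (adj i)).image (fun j => (j, i))) := by
        rintro ⟨a, b⟩ hab
        simp only [Finset.mem_filter, Finset.mem_product] at hab
        obtain ⟨⟨ha, hb⟩, hab⟩ := hab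
        simp only [Finset.mem_union, Finset.mem_filter, Finset.mem_product, Finset.mem_erase, Finset.mem_image, Prod.mk.injEq]
        by_cases h1 : a = i
        · subst h1; exact Or.inr (Or.inl ⟨b, ⟨hb, hab⟩, rfl, rfl⟩)
        · by_cases h2 : b = i
          · subst h2; exact Or.inr (Or.inr ⟨a, ⟨ha, hsymm _ _ hab⟩, rfl, rfl⟩)
          · exact Or.inl ⟨⟨⟨h1, ha⟩, ⟨h2, hb⟩⟩, hab⟩
      have h2 := Finset.card_le_card hsub
      have h3 := Finset.card_union_le (((M.erase i) ×ˢ (M.erase i)).filter fun x => adj x.1 x.2) 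
          ((M.filter (adj i)).image (fun j => (i, j)) ∪ (M.filter (adj i)).image (fun j => (j, i)))
      have h4 := Finset.card_union_le ((M.filter (adj i)).image (fun j => (i, j))) ((M.filter (adj i)).image (fun j => (j, i)))
      have h5 : ((M.filter (adj i)).image (fun j => (i, j))).card ≤ _ := Finset.card_image_le
      have h6 : ((M.filter (adj i)).image (fun j => (j, i))).card ≤ _ := Finset.card_image_le
      nlinarith
  exact H _ L subset_rfl rfl

end Poly6

section Inc

/-- the incidence relation between `(s,c,d)` and `(t,a,b)` -/
def incRel {F : Type*} [Field F] (q r : F × F × F) : Prop :=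
  q.2.1 * q.2.2 - r.2.1 * r.2.2 + q.1 * r.2.2 - r.1 * q.2.2 = 0 ∧ q.1 * r.2.2 ≠ r.1 * q.2.2 ∧
    r.2.2 ≠ 0 ∧ q.2.2 ≠ 0

instance {F : Type*} [Field F] [DecidableEq F] : DecidableRel (incRel (F := F)) := fun q r => by
  unfold incRel; infer_instance

/-- adjacency -/
def incAdj {F : Type*} [Field F] : (F × F × F) ⊕ (F × F × F) → (F × F × F) ⊕ (F × F × F) → Prop
  | Sum.inl q, Sum.inr r => incRel q r
  | Sum.inr r, Sum.inl q => incRel q r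
  | _, _ => False

instance {F : Type*} [Field F] [DecidableEq F] : DecidableRel (incAdj (F := F)) := fun x y => by
  rcases x with q | q <;> rcases y with r | r <;> unfold incAdj <;> infer_instance

theorem exists_T (p : ℕ) [Fact p.Prime] : ∃ T : AlgebraicClosure (ZMod p), ∀ x y : ZMod p,
    T * algebraMap (ZMod p) (AlgebraicClosure (ZMod p)) x + algebraMap (ZMod p) _ y = 0 → x = 0 ∧ y = 0 := by
  classical
  obtain ⟨T, hT⟩ := Infinite.exists_notMem_finset
    ((Finset.univ : Finset (ZMod p)).image (algebraMap (ZMod p) (AlgebraicClosure (ZMod p))))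
  refine ⟨T, fun x y h => ?_⟩
  have hx : x = 0 := by
    by_contra hx
    apply hT
    refine Finset.mem_image.mpr ⟨-y / x, Finset.mem_univ _, ?_⟩
    rw [map_div₀, map_neg]
    have : algebraMap (ZMod p) (AlgebraicClosure (ZMod p)) x ≠ 0 := by simpa using hx
    field_simp
    linear_combination -h
  subst hx
  simpa using h

theorem inc_bound (p : ℕ) [Fact p.Prime] (X A S : Finset (ZMod p)) (κ : ℕ) (hX : X.card ≤ κ) (hS : S.card ≤ κ)
    (Q R : Finset (ZMod p × ZMod p × ZMod p)) (hQ : Q ⊆ X ×ˢ A ×ˢ S) (hR : R ⊆ X ×ˢ A ×ˢ S)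
    (e : ℕ) (hn : (Q.card + R.card) * (3 * e + 1) < (e + 1) ^ 3) (hp : 6 * e + 1 < p) :
    ((Q ×ˢ R).filter fun x => incRel x.1 x.2).card ≤ 2 * (Q.card + R.card) * (15 * e + κ) := by
  classical
  obtain ⟨T, hT⟩ := exists_T p
  let k := AlgebraicClosure (ZMod p)
  have : CharP k p := charP_of_injective_algebraMap (algebraMap (ZMod p) k).injective p
  let g : ZMod p →+* k := algebraMap (ZMod p) k
  have hT' : ∀ x y : ZMod p, T * g x + g y = 0 → x = 0 ∧ y = 0 := hT
  have hg : Function.Injective g := (algebraMap (ZMod p) k).injective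
  have hT0 : T ≠ 0 := by
    rintro rfl
    have := (hT' 1 0 (by simp)).1
    exact one_ne_zero this
  have hTi : T * T⁻¹ = 1 := mul_inv_cancel₀ hT0
  let μ : (ZMod p × ZMod p × ZMod p) ⊕ (ZMod p × ZMod p × ZMod p) → k := 
    Sum.elim (fun q => T * g q.1) (fun r => g r.1)
  let u : (ZMod p × ZMod p × ZMod p) ⊕ (ZMod p × ZMod p × ZMod p) → k := 
    Sum.elim (fun q => - g (q.2.1 * q.2.2)) (fun r => - g (r.2.1 * r.2.2))
  let v : (ZMod p × ZMod p × ZMod p) ⊕ (ZMod p × ZMod p × ZMod p) → k := 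
    Sum.elim (fun q => g q.2.2) (fun r => g r.2.2 / T)
  have main := edge_bound (k := k) p (Q.disjSum R) μ u v incAdj ?_ ?_ ?_ ?_ κ ?_ e (by rwa [Finset.card_disjSum]) hp
  · rw [Finset.card_disjSum] at main
    refine le_trans ?_ main
    apply Finset.card_le_card_of_injOn (fun x => (Sum.inl x.1, Sum.inr x.2))
    · intro x hx
      simp only [Finset.coe_filter, Finset.mem_product, Set.mem_ofPred_eq] at hx ⊢
      simpa [incAdj] using hx
    · rintro ⟨a, b⟩ _ ⟨c, d⟩ _ h
      simp only [Prod.mk.injEq, Sum.inl.injEq, Sum.inr.injEq] at h; rw [h.1, h.2]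
  · rintro (i | i) (j | j) h <;> simpa [incAdj] using h
  · have : ∀ q r, incRel (F := ZMod p) q r → T * g q.1 ≠ g r.1 := by
      rintro ⟨s, c, d⟩ ⟨t, a, b⟩ ⟨h1, h2, h3, h4⟩ h
      obtain ⟨h5, h6⟩ := hT' s (-t) (by simp only at h; rw [h]; simp)
      simp only at h2
      apply h2
      rw [h5, neg_eq_zero.mp h6]; simp
    rintro (i | i) (j | j) h <;> simp only [incAdj] at h
    · exact this i j h
    · exact (this j i h).symm
  · have : ∀ q r, incRel (F := ZMod p) q r → - g (r.2.1 * r.2.2) - - g (q.2.1 * q.2.2) + T * g q.1 * (g r.2.2 / T) - g r.1 * g q.2.2 = 0 := by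
      rintro ⟨s, c, d⟩ ⟨t, a, b⟩ ⟨h1, h2, h3, h4⟩
      simp only at h1 ⊢
      have h := congrArg g h1
      simp only [map_add, map_sub, map_mul, map_zero] at h ⊢
      field_simp
      linear_combination h
    rintro (i | i) (j | j) h <;> simp only [incAdj] at h
    · exact this i j h
    · have := this j i h
      simp only [u, v, μ, Sum.elim_inl, Sum.elim_inr]
      linear_combination -this
  · rintro (⟨s, c, d⟩ | ⟨t, a, b⟩) (⟨s1, c1, d1⟩ | ⟨t1, a1, b1⟩) (⟨s2, c2, d2⟩ | ⟨t2, a2, b2⟩) h1 h2 h <;> simp only [incAdj] at h1 h2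
    · simp only [μ, v, Sum.elim_inl, Sum.elim_inr] at h
      obtain ⟨x1, x2, x3, x4⟩ := h1
      obtain ⟨y1, y2, y3, y4⟩ := h2
      simp only at x1 x2 x3 x4 y1 y2 y3 y4
      obtain ⟨e1, e2⟩ := hT' (-d * t2 - b1 * s + d * t1 + b2 * s) (b1 * t2 - b2 * t1) (by
        simp only [map_add, map_sub, map_mul, map_neg]
        simp only [div_eq_mul_inv] at h
        linear_combination T * h + (g b1 * (T * g s - g t2) - g b2 * (T * g s - g t1)) * hTi)
      have e3 : (b2 - b1) * (s * b1 - t1 * d) = 0 := by linear_combination d * e2 + b1 * e1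
      have e4 : b2 = b1 := by
        rcases mul_eq_zero.mp e3 with h | h
        · exact sub_eq_zero.mp h
        · exact absurd (sub_eq_zero.mp h) x2
      subst e4
      have e5 : t1 = t2 := by
        apply mul_left_cancel₀ y4; linear_combination e1
      subst e5
      have e6 : a1 = a2 := by
        apply mul_right_cancel₀ x3; linear_combination y1 - x1
      subst e6; rfl
    · simp only [μ, v, Sum.elim_inl, Sum.elim_inr] at h
      obtain ⟨x1, x2, x3, x4⟩ := h1
      obtain ⟨y1, y2, y3, y4⟩ := h2
      simp only at x1 x2 x3 x4 y1 y2 y3 y4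
      obtain ⟨e1, e2⟩ := hT' (d1 * s2 - d2 * s1) (-b * s2 - d1 * t + b * s1 + d2 * t)  (by
        simp only [map_add, map_sub, map_mul, map_neg]
        simp only [div_eq_mul_inv] at h
        apply mul_left_cancel₀ hT0
        linear_combination T * h - g b * ((g t - T * g s2) - (g t - T * g s1)) * hTi)
      have e3 : (d2 - d1) * (s1 * b - t * d1) = 0 := by linear_combination -b * e1 - d1 * e2
      have e4 : d2 = d1 := by
        rcases mul_eq_zero.mp e3 with h | h
        · exact sub_eq_zero.mp h
        · exact absurd (sub_eq_zero.mp h) x2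
      subst e4
      have e5 : s1 = s2 := by
        apply mul_left_cancel₀ y3; linear_combination e2
      subst e5
      have e6 : c1 = c2 := by
        apply mul_right_cancel₀ x4; linear_combination x1 - y1
      subst e6; rfl
  · rintro (⟨s, c, d⟩ | ⟨t, a, b⟩) E f
    · by_cases hf : f = 0
      · subst hf
        refine le_trans (Finset.card_le_card_of_injOn (t := X) (Sum.elim (fun q => q.1) (fun q => q.1)) ?_ ?_) hX
        · rintro (j | j) hj
          · exact (Finset.mem_filter.mp hj).2.1.elim
          · have := hR (by simpa using (Finset.mem_filter.mp hj).1)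
            simp only [Finset.mem_product] at this
            exact this.1
        · rintro (j | ⟨t1, a1, b1⟩) hj (j' | ⟨t2, a2, b2⟩) hj' h
          · exact (Finset.mem_filter.mp hj).2.1.elim
          · exact (Finset.mem_filter.mp hj).2.1.elim
          · exact (Finset.mem_filter.mp hj').2.1.elim
          · obtain ⟨-, h1, h3⟩ := Finset.mem_filter.mp hj
            obtain ⟨-, h2, h4⟩ := Finset.mem_filter.mp hj'
            simp only [incAdj] at h1 h2
            simp only [μ, v, Sum.elim_inl, Sum.elim_inr, zero_mul, add_zero] at h h3 h4
            subst h
            obtain ⟨x1, x2, x3, x4⟩ := h1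
            obtain ⟨y1, y2, y3, y4⟩ := h2
            simp only at x1 x2 x3 x4 y1 y2 y3 y4
            have hE : E ≠ 0 := by rintro rfl; simp at h3
            have : b1 = b2 := by
              apply hg
              have := mul_left_cancel₀ hE (h3.symm.trans h4)
              have h9 : g b1 / T = g b2 / T := by linear_combination this
              exact (div_left_inj' hT0).mp h9
            subst this
            have e6 : a1 = a2 := by
              apply mul_right_cancel₀ x3; linear_combination y1 - x1
            subst e6; rfl
      · refine le_trans (Finset.card_le_card_of_injOn (t := S) (Sum.elim (fun q => q.2.2) (fun q => q.2.2)) ?_ ?_) hS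
        · rintro (j | j) hj
          · exact (Finset.mem_filter.mp hj).2.1.elim
          · have := hR (by simpa using (Finset.mem_filter.mp hj).1)
            simp only [Finset.mem_product] at this
            exact this.2.2
        · rintro (j | ⟨t1, a1, b1⟩) hj (j' | ⟨t2, a2, b2⟩) hj' h
          · exact (Finset.mem_filter.mp hj).2.1.elim
          · exact (Finset.mem_filter.mp hj).2.1.elim
          · exact (Finset.mem_filter.mp hj').2.1.elim
          · obtain ⟨-, h1, h3⟩ := Finset.mem_filter.mp hj
            obtain ⟨-, h2, h4⟩ := Finset.mem_filter.mp hj'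
            simp only [incAdj] at h1 h2
            simp only [μ, v, Sum.elim_inl, Sum.elim_inr] at h h3 h4
            subst h
            obtain ⟨x1, x2, x3, x4⟩ := h1
            obtain ⟨y1, y2, y3, y4⟩ := h2
            simp only at x1 x2 x3 x4 y1 y2 y3 y4
            have : t1 = t2 := by
              apply hg
              apply mul_left_cancel₀ hf
              linear_combination h4 - h3
            subst this
            have e6 : a1 = a2 := by
              apply mul_right_cancel₀ x3; linear_combination y1 - x1
            subst e6; rfl
    · by_cases hf : f = 0
      · subst hf
        refine le_trans (Finset.card_le_card_of_injOn (t := X) (Sum.elim (fun q => q.1) (fun q => q.1)) ?_ ?_) hX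
        · rintro (j | j) hj
          · have := hQ (by simpa using (Finset.mem_filter.mp hj).1)
            simp only [Finset.mem_product] at this
            exact this.1
          · exact (Finset.mem_filter.mp hj).2.1.elim
        · rintro (⟨t1, a1, b1⟩ | j) hj (⟨t2, a2, b2⟩ | j') hj' h
          · obtain ⟨-, h1, h3⟩ := Finset.mem_filter.mp hj
            obtain ⟨-, h2, h4⟩ := Finset.mem_filter.mp hj'
            simp only [incAdj] at h1 h2
            simp only [μ, v, Sum.elim_inl, Sum.elim_inr, zero_mul, add_zero] at h h3 h4
            subst h
            obtain ⟨x1, x2, x3, x4⟩ := h1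
            obtain ⟨y1, y2, y3, y4⟩ := h2
            simp only at x1 x2 x3 x4 y1 y2 y3 y4
            have hE : E ≠ 0 := by rintro rfl; simp at h3
            have : b1 = b2 := by
              apply hg
              have := mul_left_cancel₀ hE (h3.symm.trans h4)
              linear_combination this
            subst this
            have e6 : a1 = a2 := by
              apply mul_right_cancel₀ x4; linear_combination x1 - y1
            subst e6; rfl
          · exact (Finset.mem_filter.mp hj').2.1.elim
          · exact (Finset.mem_filter.mp hj).2.1.elim
          · exact (Finset.mem_filter.mp hj).2.1.elim
      · refine le_trans (Finset.card_le_card_of_injOn (t := S) (Sum.elim (fun q => q.2.2) (fun q => q.2.2)) ?_ ?_) hS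
        · rintro (j | j) hj
          · have := hQ (by simpa using (Finset.mem_filter.mp hj).1)
            simp only [Finset.mem_product] at this
            exact this.2.2
          · exact (Finset.mem_filter.mp hj).2.1.elim
        · rintro (⟨t1, a1, b1⟩ | j) hj (⟨t2, a2, b2⟩ | j') hj' h
          · obtain ⟨-, h1, h3⟩ := Finset.mem_filter.mp hj
            obtain ⟨-, h2, h4⟩ := Finset.mem_filter.mp hj'
            simp only [incAdj] at h1 h2
            simp only [μ, v, Sum.elim_inl, Sum.elim_inr] at h h3 h4
            subst h
            obtain ⟨x1, x2, x3, x4⟩ := h1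
            obtain ⟨y1, y2, y3, y4⟩ := h2
            simp only at x1 x2 x3 x4 y1 y2 y3 y4
            have : t1 = t2 := by
              apply hg
              apply mul_left_cancel₀ hf
              apply mul_left_cancel₀ hT0
              linear_combination h4 - h3
            subst this
            have e6 : a1 = a2 := by
              apply mul_right_cancel₀ x4; linear_combination x1 - y1
            subst e6; rfl
          · exact (Finset.mem_filter.mp hj').2.1.elim
          · exact (Finset.mem_filter.mp hj).2.1.elim
          · exact (Finset.mem_filter.mp hj).2.1.elim

end Inc

section Inc2

theorem chunk {α : Type*} [DecidableEq α] (f : Finset α → ℕ) (hf : ∀ U V, f (U ∪ V) ≤ f U + f V) (M B : ℕ)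
    (hM : 0 < M) (Z : Finset α) (hB : ∀ U ⊆ Z, U.card ≤ M → f U ≤ B) : f Z ≤ (Z.card / M + 1) * B := by
  induction hn : Z.card using Nat.strong_induction_on generalizing Z with
  | _ n ih =>
    by_cases h : Z.card ≤ M
    · have := hB Z subset_rfl h
      nlinarith [Nat.zero_le (n / M * B)]
    · push Not at h
      obtain ⟨U, hU, hUc⟩ := Finset.exists_subset_card_eq h.le
      have h1 := ih (n - M) (by omega) (Z \ U) (fun V hV => hB V (hV.trans Finset.sdiff_subset)) (by
        rw [Finset.card_sdiff_of_subset hU]; omega)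
      have h2 := hf U (Z \ U)
      rw [Finset.union_sdiff_of_subset hU] at h2
      have h3 := hB U hU hUc.le
      have h4 : (n - M) / M + 1 = n / M := by
        have := Nat.div_eq_sub_div hM (show M ≤ n by omega)
        omega
      rw [h4] at h1
      linarith [add_mul (n / M) 1 B]

/-- Number of incidences. -/
def incCount {F : Type*} [Field F] [DecidableEq F] (Q R : Finset (F × F × F)) : ℕ :=
  ((Q ×ˢ R).filter fun x => incRel x.1 x.2).card

theorem incCount_union_left {F : Type*} [Field F] [DecidableEq F] (R U V : Finset (F × F × F)) :
    incCount (U ∪ V) R ≤ incCount U R + incCount V R := by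
  unfold incCount
  rw [Finset.union_product, Finset.filter_union]
  exact Finset.card_union_le _ _

theorem incCount_union_right {F : Type*} [Field F] [DecidableEq F] (R U V : Finset (F × F × F)) :
    incCount R (U ∪ V) ≤ incCount R U + incCount R V := by
  unfold incCount
  rw [Finset.product_union, Finset.filter_union]
  exact Finset.card_union_le _ _

theorem inc_full (p : ℕ) [Fact p.Prime] (X A S : Finset (ZMod p)) (κ : ℕ) (hX : X.card ≤ κ) (hS : S.card ≤ κ)
    (hκ : κ ≤ p) (m : ℕ) (hm : (X ×ˢ A ×ˢ S).card = m) (hm1 : 1 ≤ m) :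
    (incCount (X ×ˢ A ×ˢ S) (X ×ˢ A ×ˢ S) : ℝ) ≤ 10 ^ 6 * (m * Real.sqrt m + κ * m + m ^ 2 / p) := by
  set Z := X ×ˢ A ×ˢ S with hZ
  have hp0 : (0:ℝ) < p := by exact_mod_cast (Fact.out : p.Prime).pos
  have hmR : (1:ℝ) ≤ m := by exact_mod_cast hm1
  by_cases hA : 6 * Nat.sqrt (6 * m) + 1 < p
  · have h1 := inc_bound p X A S κ hX hS Z Z subset_rfl subset_rfl (Nat.sqrt (6 * m)) (by
      rw [hm]
      have := Nat.lt_succ_sqrt (6 * m)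
      set e := Nat.sqrt (6 * m)
      simp only [Nat.succ_eq_add_one] at this
      calc (m + m) * (3 * e + 1) ≤ (6 * m) * (e + 1) := by nlinarith
        _ < ((e+1) * (e+1)) * (e + 1) := by apply Nat.mul_lt_mul_of_pos_right this; omega
        _ = (e+1)^3 := by ring) hA
    rw [hm] at h1
    change incCount Z Z ≤ _ at h1
    have h2 : (incCount Z Z : ℝ) ≤ 2 * (m + m) * (15 * (Nat.sqrt (6 * m) : ℕ) + κ) := by exact_mod_cast h1
    have h3 : ((Nat.sqrt (6 * m) : ℕ) : ℝ) ≤ 3 * Real.sqrt m := by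
      have : ((Nat.sqrt (6 * m) : ℕ) : ℝ) ≤ Real.sqrt (6 * m) := by
        have := Real.nat_sqrt_le_real_sqrt (a := 6 * m)
        push_cast at this; exact this
      refine this.trans ?_
      rw [Real.sqrt_le_left (by positivity), mul_pow, Real.sq_sqrt (by positivity)]
      nlinarith
    have h4 : (0:ℝ) ≤ m ^ 2 / p := by positivity
    have h5 : (0:ℝ) ≤ κ * m := by positivity
    have h6 : (0:ℝ) ≤ m * Real.sqrt m := by positivity
    nlinarith
  · by_cases hps : p < 20
    · have h1 : incCount Z Z ≤ m * m := by
        unfold incCount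
        refine (Finset.card_filter_le _ _).trans ?_
        rw [Finset.card_product, hm]
      have h2 : (incCount Z Z : ℝ) ≤ m * m := by exact_mod_cast h1
      have h3 : (p:ℝ) ≤ 20 := by exact_mod_cast hps.le
      have h4 : (m:ℝ) ^ 2 / 20 ≤ m ^ 2 / p := by gcongr
      have h5 : (0:ℝ) ≤ κ * m := by positivity
      have h6 : (0:ℝ) ≤ m * Real.sqrt m := by positivity
      nlinarith
    · push Not at hA hps
      set e := (p - 2) / 6 with he
      set M := (e + 1) ^ 2 / 6 with hM
      have he3 : 3 ≤ e := by omega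
      have hM1 : (e + 1) ^ 2 ≤ 6 * M + 5 := by omega
      have hM2 : 6 * M ≤ (e + 1) ^ 2 := by omega
      have hMpos : 0 < M := by nlinarith
      have key : ∀ U ⊆ Z, U.card ≤ M → ∀ V ⊆ Z, V.card ≤ M → incCount U V ≤ 4 * M * (15 * e + κ) := by
        intro U hU hUc V hV hVc
        refine (inc_bound p X A S κ hX hS U V hU hV e ?_ (by omega)).trans ?_
        · calc (U.card + V.card) * (3 * e + 1) ≤ (M + M) * (3 * e + 1) := by gcongr
            _ < 6 * M * (e + 1) := by nlinarith
            _ ≤ (e+1)^2 * (e + 1) := by gcongr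
            _ = _ := by ring
        · apply Nat.mul_le_mul_right; omega
      have s1 : ∀ U ⊆ Z, U.card ≤ M → incCount U Z ≤ (m / M + 1) * (4 * M * (15 * e + κ)) := by
        intro U hU hUc
        have := chunk (fun V => incCount U V) (fun V W => incCount_union_right U V W) M _ hMpos Z (key U hU hUc)
        rwa [hm] at this
      have s2 := chunk (fun U => incCount U Z) (fun V W => incCount_union_left Z V W) M _ hMpos Z s1
      rw [hm] at s2
      have s3 : (incCount Z Z : ℝ) ≤ (m / M + 1) * ((m / M + 1) * (4 * M * (15 * e + κ))) := by
        have : (incCount Z Z : ℝ) ≤ (((m / M + 1) * ((m / M + 1) * (4 * M * (15 * e + κ))) : ℕ) : ℝ) := by exact_mod_cast s2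
        refine this.trans ?_
        push_cast
        have h7 : ((m / M : ℕ) : ℝ) ≤ (m:ℝ) / M := Nat.cast_div_le
        gcongr
      have hpR : (20:ℝ) ≤ p := by exact_mod_cast hps
      have heR : (p:ℝ) ≤ 6 * e + 7 := by
        have : p ≤ 6 * e + 7 := by omega
        exact_mod_cast this
      have heR' : 6 * (e:ℝ) ≤ p := by
        have : 6 * e ≤ p := by omega
        exact_mod_cast this
      have hM1R : ((e:ℝ) + 1) ^ 2 ≤ 6 * M + 5 := by exact_mod_cast hM1
      have hM2R : 6 * (M:ℝ) ≤ (e + 1) ^ 2 := by exact_mod_cast hM2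
      have he3R : (3:ℝ) ≤ e := by exact_mod_cast he3
      have hκR : (κ:ℝ) ≤ p := by exact_mod_cast hκ
      have hMp : (M:ℝ) ≤ p ^ 2 / 96 := by nlinarith
      have hMp' : (p:ℝ) ^ 2 / 500 ≤ M := by nlinarith
      have hmp : (p:ℝ) ^ 2 / 240 ≤ m := by
        have h8 : (p:ℝ) ≤ 6 * (Nat.sqrt (6 * m) : ℕ) + 1 := by exact_mod_cast hA
        have h9 : ((Nat.sqrt (6 * m) : ℕ) : ℝ) ^ 2 ≤ 6 * m := by exact_mod_cast Nat.sqrt_le' (6 * m)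
        nlinarith
      have hMR : (0:ℝ) < M := by exact_mod_cast hMpos
      have hdiv : (m:ℝ) / M + 1 ≤ 740 * m / p ^ 2 := by
        have h8 : (m:ℝ) / M ≤ m / (p ^ 2 / 500) := by gcongr
        have h9 : (m:ℝ) / (p ^ 2 / 500) = 500 * (m / p ^ 2) := by field_simp
        have h10 : (1:ℝ) ≤ 240 * (m / p ^ 2) := by
          rw [← mul_div_assoc, le_div_iff₀ (by positivity)]; linarith
        have h11 : 740 * (m:ℝ) / p ^ 2 = 740 * (m / p ^ 2) := by ring
        rw [h11]; linarith
      have h12 : (incCount Z Z : ℝ) ≤ (740 * m / p ^ 2) * ((740 * m / p ^ 2) * (4 * (p ^ 2 / 96) * (4 * p))) := by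
        refine s3.trans ?_
        gcongr
        linarith
      have h13 : ((740:ℝ) * m / p ^ 2) * ((740 * m / p ^ 2) * (4 * (p ^ 2 / 96) * (4 * p))) = (740 ^ 2 * 16 / 96) * (m ^ 2 / p) := by
        field_simp
        norm_num
      rw [h13] at h12
      have h4 : (0:ℝ) ≤ m ^ 2 / p := by positivity
      have h5 : (0:ℝ) ≤ κ * m := by positivity
      have h6 : (0:ℝ) ≤ m * Real.sqrt m := by positivity
      nlinarith

end Inc2

section Energy

/-- Multiplicative energy. -/
def mulEn {F : Type*} [Field F] [DecidableEq F] (S : Finset F) : ℕ :=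
  (((S ×ˢ S) ×ˢ (S ×ˢ S)).filter fun w => w.1.1 * w.1.2 = w.2.1 * w.2.2).card

theorem zero_pairs {F : Type*} [Field F] [DecidableEq F] (S : Finset F) :
    ((S ×ˢ S).filter fun w => w.1 * w.2 = 0).card ≤ 2 * S.card := by
  have : ((S ×ˢ S).filter fun w => w.1 * w.2 = 0) ⊆ ({0} ×ˢ S) ∪ (S ×ˢ {0}) := by
    intro w hw
    simp only [Finset.mem_filter, Finset.mem_product, mul_eq_zero, Finset.mem_union, Finset.mem_singleton] at hw ⊢
    tauto
  refine (Finset.card_le_card this).trans ((Finset.card_union_le _ _).trans ?_)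
  simp [Finset.card_product]; omega

theorem mulEn_split {F : Type*} [Field F] [DecidableEq F] (S : Finset F) :
    mulEn S ≤ 4 * S.card ^ 2 + (((S ×ˢ S) ×ˢ (S ×ˢ S)).filter fun w =>
      w.1.1 * w.1.2 = w.2.1 * w.2.2 ∧ w.1.1 * w.1.2 ≠ 0).card := by
  unfold mulEn
  set P := (S ×ˢ S).filter fun w => w.1 * w.2 = 0 with hP
  have h : (((S ×ˢ S) ×ˢ (S ×ˢ S)).filter fun w => w.1.1 * w.1.2 = w.2.1 * w.2.2) ⊆ (P ×ˢ P) ∪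
      (((S ×ˢ S) ×ˢ (S ×ˢ S)).filter fun w => w.1.1 * w.1.2 = w.2.1 * w.2.2 ∧ w.1.1 * w.1.2 ≠ 0) := by
    rintro ⟨⟨a, b⟩, c, d⟩ hw
    simp only [hP, Finset.mem_filter, Finset.mem_product, Finset.mem_union] at hw ⊢
    by_cases h0 : a * b = 0
    · left; refine ⟨⟨hw.1.1, h0⟩, hw.1.2, ?_⟩; rw [← hw.2]; exact h0
    · right; exact ⟨hw.1, hw.2, h0⟩
  refine (Finset.card_le_card h).trans ((Finset.card_union_le _ _).trans ?_)
  have := zero_pairs S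
  rw [Finset.card_product]
  have h2 : P.card * P.card ≤ (2 * S.card) * (2 * S.card) := Nat.mul_le_mul this this
  nlinarith

theorem energy_inc {F : Type*} [Field F] [DecidableEq F] (S A : Finset F) :
    (((S ×ˢ S) ×ˢ (S ×ˢ S)).filter fun w =>
      w.1.1 * w.1.2 = w.2.1 * w.2.2 ∧ w.1.1 * w.1.2 ≠ 0).card * A.card ^ 2 ≤
      incCount ((S + A) ×ˢ A ×ˢ S) ((S + A) ×ˢ A ×ˢ S) + (S + A).card * A.card * S.card ^ 2 := by
  set W := ((S ×ˢ S) ×ˢ (S ×ˢ S)).filter fun w =>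
      w.1.1 * w.1.2 = w.2.1 * w.2.2 ∧ w.1.1 * w.1.2 ≠ 0 with hW
  set Z := (S + A) ×ˢ A ×ˢ S with hZ
  set I1 := (Z ×ˢ Z).filter fun x => incRel x.1 x.2 with hI1
  set I2 := (Z ×ˢ Z).filter fun x => x.1.1 * x.2.2.2 = x.2.1 * x.1.2.2 ∧ x.2.2.1 * x.2.2.2 = x.1.2.1 * x.1.2.2 ∧ x.1.2.2 ≠ 0 ∧ x.2.2.2 ≠ 0 with hI2
  have h1 : W.card * A.card ^ 2 = (W ×ˢ (A ×ˢ A)).card := by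
    rw [Finset.card_product, Finset.card_product, sq]
  have h2 : (W ×ˢ (A ×ˢ A)).card ≤ (I1 ∪ I2).card := by
    apply Finset.card_le_card_of_injOn (fun w => ((w.1.1.1 + w.2.1, w.2.2, w.1.2.2), (w.1.2.1 + w.2.2, w.2.1, w.1.1.2)))
    · rintro ⟨⟨⟨s, s'⟩, t, t'⟩, a, c⟩ hw
      simp only [hW, hI1, hI2, hZ, Finset.coe_product, Finset.coe_filter, Finset.mem_filter, Finset.mem_product, Set.mem_prod, Set.mem_ofPred_eq, Finset.mem_coe, Finset.coe_union, Set.mem_union] at hw ⊢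
      obtain ⟨⟨⟨⟨hs, hs'⟩, ht, ht'⟩, he, hne⟩, ha, hc⟩ := hw
      have hne' := hne
      rw [he] at hne'
      have m1 := Finset.add_mem_add hs ha
      have m2 := Finset.add_mem_add ht hc
      by_cases hx : (s + a) * s' = (t + c) * t'
      · right
        refine ⟨⟨⟨m1, hc, ht'⟩, m2, ha, hs'⟩, hx, ?_, right_ne_zero_of_mul hne', right_ne_zero_of_mul hne⟩
        linear_combination hx - he
      · left
        refine ⟨⟨⟨m1, hc, ht'⟩, m2, ha, hs'⟩, ?_, hx, right_ne_zero_of_mul hne, right_ne_zero_of_mul hne'⟩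
        show c * t' - a * s' + (s + a) * s' - (t + c) * t' = 0
        linear_combination he
    · rintro ⟨⟨⟨s, s'⟩, t, t'⟩, a, c⟩ - ⟨⟨⟨s1, s1'⟩, t1, t1'⟩, a1, c1⟩ - h
      simp only [Prod.mk.injEq] at h ⊢
      obtain ⟨⟨h1, rfl, rfl⟩, h2, rfl, rfl⟩ := h
      refine ⟨⟨⟨add_right_cancel h1, rfl⟩, add_right_cancel h2, rfl⟩, rfl, rfl⟩
  have h3 : I2.card ≤ ((S + A) ×ˢ A ×ˢ (S ×ˢ S)).card := by
    apply Finset.card_le_card_of_injOn (fun w => (w.1.1, w.2.2.1, w.1.2.2, w.2.2.2))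
    · rintro ⟨⟨x, c, d⟩, y, a, b⟩ hw
      simp only [hI2, hZ, Finset.coe_product, Finset.coe_filter, Finset.mem_product, Set.mem_prod, Set.mem_ofPred_eq, Finset.mem_coe] at hw ⊢
      tauto
    · rintro ⟨⟨x, c, d⟩, y, a, b⟩ hw ⟨⟨x1, c1, d1⟩, y1, a1, b1⟩ hw1 h
      simp only [hI2, Finset.coe_filter, Set.mem_ofPred_eq] at hw hw1
      simp only [Prod.mk.injEq] at h ⊢
      obtain ⟨rfl, rfl, rfl, rfl⟩ := h
      have hy : y = y1 := mul_right_cancel₀ hw.2.2.2.1 (hw.2.1.symm.trans hw1.2.1)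
      have hc : c = c1 := mul_right_cancel₀ hw.2.2.2.1 (hw.2.2.1.symm.trans hw1.2.2.1)
      subst hy hc
      simp
  rw [h1]
  refine h2.trans ((Finset.card_union_le _ _).trans ?_)
  have h4 : ((S + A) ×ˢ A ×ˢ (S ×ˢ S)).card = (S + A).card * A.card * S.card ^ 2 := by
    simp only [Finset.card_product]; ring
  rw [h4] at h3
  exact Nat.add_le_add_left h3 _

theorem card_3A {p : ℕ} (A : Finset (ZMod p)) (K : ℝ) (hK : ((A + A).card : ℝ) ≤ K * A.card) (hA : A.Nonempty) :
    ((A + A + A).card : ℝ) ≤ K ^ 3 * A.card := by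
  have h := Finset.pluennecke_ruzsa_inequality_nsmul_add hA A 3
  have h3 : (3 • A) = A + A + A := by
    rw [succ_nsmul, two_nsmul]
  rw [h3] at h
  have hN : (0:ℝ) < A.card := by exact_mod_cast hA.card_pos
  have h' : ((A + A + A).card : ℝ) ≤ ((A + A).card / A.card : ℝ) ^ 3 * A.card := by
    have := NNRat.cast_le (K := ℝ) |>.2 h
    push_cast at this
    exact this
  refine h'.trans ?_
  gcongr
  rw [div_le_iff₀ hN]; exact hK

theorem energy_bound (p : ℕ) [Fact p.Prime] (A : Finset (ZMod p)) (K : ℝ) (hK1 : 1 ≤ K)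
    (hK : ((A + A).card : ℝ) ≤ K * A.card) (hA : A.Nonempty) (hKN : K ^ 2 ≤ A.card) :
    (mulEn (A + A) : ℝ) ≤ 10 ^ 7 * (K ^ 6 * A.card ^ 2 * Real.sqrt A.card + K ^ 8 * A.card ^ 4 / p) := by
  set S := A + A with hS
  set N : ℝ := (A.card : ℝ) with hN
  have hN1 : (1:ℝ) ≤ N := by rw [hN]; exact_mod_cast hA.card_pos
  have hp0 : (0:ℝ) < p := by exact_mod_cast (Fact.out : p.Prime).pos
  have h3 := card_3A A K hK hA
  rw [← hS, ← hN] at h3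
  have e1 := mulEn_split S
  have e2 := energy_inc S A
  set W := (((S ×ˢ S) ×ˢ (S ×ˢ S)).filter fun w =>
      w.1.1 * w.1.2 = w.2.1 * w.2.2 ∧ w.1.1 * w.1.2 ≠ 0).card
  have hSA : S.card ≤ (S + A).card := Finset.card_le_card_add_right hA
  have hSne : S.Nonempty := hA.add hA
  have e3 := inc_full p (S + A) A S (S + A).card le_rfl hSA (by
    simpa [ZMod.card] using Finset.card_le_univ (S + A)) _ rfl (by
      apply Finset.card_pos.2
      exact (hSne.add hA).product (hA.product hSne))
  set J := incCount ((S + A) ×ˢ A ×ˢ S) ((S + A) ×ˢ A ×ˢ S)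
  have e1' : (mulEn S : ℝ) ≤ 4 * (S.card : ℝ) ^ 2 + W := by exact_mod_cast e1
  have e2' : (W : ℝ) * N ^ 2 ≤ J + (S + A).card * N * (S.card : ℝ) ^ 2 := by rw [hN]; exact_mod_cast e2
  simp only [Finset.card_product] at e3
  push_cast at e3
  rw [← hN] at e3
  set x : ℝ := ((S + A).card : ℝ) with hx
  set y : ℝ := (S.card : ℝ) with hy
  have hx0 : 0 ≤ x := by positivity
  have hy0 : 0 ≤ y := by positivity
  have hm : x * (N * y) ≤ K ^ 4 * N ^ 3 := by
    calc x * (N * y) ≤ (K ^ 3 * N) * (N * (K * N)) := by gcongr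
      _ = _ := by ring
  have hm0 : 0 ≤ x * (N * y) := by positivity
  have hsq : Real.sqrt (x * (N * y)) ≤ K ^ 2 * N * Real.sqrt N := by
    rw [Real.sqrt_le_left (by positivity), mul_pow, Real.sq_sqrt (by positivity)]
    refine hm.trans (le_of_eq ?_); ring
  have hJ : (J:ℝ) ≤ 10 ^ 6 * ((K ^ 4 * N ^ 3) * (K ^ 2 * N * Real.sqrt N) + (K ^ 3 * N) * (K ^ 4 * N ^ 3) + (K ^ 4 * N ^ 3) ^ 2 / p) := by
    refine e3.trans ?_
    gcongr
  have hsN : K ≤ Real.sqrt N := Real.le_sqrt_of_sq_le hKN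
  have hxy : x * N * y ^ 2 ≤ K ^ 5 * N ^ 4 := by
    calc x * N * y ^ 2 ≤ (K ^ 3 * N) * N * (K * N) ^ 2 := by gcongr
      _ = _ := by ring
  set q := Real.sqrt N
  have hq1 : 1 ≤ q := hK1.trans hsN
  have hW : (W:ℝ) ≤ 10 ^ 6 * (K ^ 6 * N ^ 2 * q + K ^ 7 * N ^ 2 + K ^ 8 * N ^ 4 / p) + K ^ 5 * N ^ 2 := by
    have hN2 : 0 < N ^ 2 := by positivity
    refine le_of_mul_le_mul_right ?_ hN2
    refine e2'.trans ((add_le_add hJ hxy).trans (le_of_eq ?_))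
    ring
  have hyy : y ^ 2 ≤ K ^ 2 * N ^ 2 := by rw [← mul_pow]; gcongr
  have t1 : K ^ 7 * N ^ 2 ≤ K ^ 6 * N ^ 2 * q := by
    calc K ^ 7 * N ^ 2 = K ^ 6 * N ^ 2 * K := by ring
      _ ≤ _ := by gcongr
  have t2 : K ^ 5 * N ^ 2 ≤ K ^ 6 * N ^ 2 * q := by
    calc K ^ 5 * N ^ 2 = K ^ 5 * N ^ 2 * 1 := by ring
      _ ≤ K ^ 6 * N ^ 2 * q := by gcongr; norm_num
  have t3 : K ^ 2 * N ^ 2 ≤ K ^ 6 * N ^ 2 * q := by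
    calc K ^ 2 * N ^ 2 = K ^ 2 * N ^ 2 * 1 := by ring
      _ ≤ K ^ 6 * N ^ 2 * q := by gcongr; norm_num
  have t4 : 0 ≤ K ^ 8 * N ^ 4 / p := by positivity
  linarith

end Energy

section Moments

variable {F : Type*} [Field F] [Fintype F] [DecidableEq F]

theorem corr_zero (f : F → ℝ) (hf : ∑ u, f u = 0) (k l : F) (h : k ≠ l) :
    ∑ c : F, ∑ a : F, f (a + c * k) * f (a + c * l) = 0 := by
  have h1 : ∀ c : F, ∑ a : F, f (a + c * k) * f (a + c * l) = ∑ a : F, f a * f (a + c * (l - k)) := by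
    intro c
    rw [← Equiv.sum_comp (Equiv.addRight (c * k)) (fun a => f a * f (a + c * (l - k)))]
    refine Finset.sum_congr rfl fun a _ => ?_
    simp only [Equiv.coe_addRight]
    congr 2; ring
  simp_rw [h1]
  rw [Finset.sum_comm]
  refine Finset.sum_eq_zero fun a _ => ?_
  rw [← Finset.mul_sum]
  have h2 : ∑ c : F, f (a + c * (l - k)) = ∑ u, f u := by
    have hlk : l - k ≠ 0 := sub_ne_zero.2 h.symm
    exact Equiv.sum_comp ((Equiv.mulRight₀ (l - k) hlk).trans (Equiv.addLeft a)) f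
  rw [h2, hf, mul_zero]

theorem corr_diag (f : F → ℝ) (k : F) :
    ∑ c : F, ∑ a : F, f (a + c * k) * f (a + c * k) = Fintype.card F * ∑ u, f u ^ 2 := by
  have h1 : ∀ c : F, ∑ a : F, f (a + c * k) * f (a + c * k) = ∑ u, f u ^ 2 := by
    intro c
    rw [← Equiv.sum_comp (Equiv.addRight (c * k)) (fun a => f a ^ 2)]
    refine Finset.sum_congr rfl fun a _ => ?_
    simp only [Equiv.coe_addRight]
    ring
  simp_rw [h1]
  simp

theorem second_moment (f : F → ℝ) (hf : ∑ u, f u = 0) :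
    ∑ b : F, ∑ c : F, ∑ a : F, (∑ u, f u * f (a + c * (u - b)⁻¹)) ^ 2 =
      (Fintype.card F : ℝ) ^ 2 * (∑ u, f u ^ 2) ^ 2 := by
  have h1 : ∀ b : F, ∑ c : F, ∑ a : F, (∑ u, f u * f (a + c * (u - b)⁻¹)) ^ 2 =
      (Fintype.card F : ℝ) * (∑ u, f u ^ 2) ^ 2 := by
    intro b
    have e1 : ∀ c a : F, (∑ u, f u * f (a + c * (u - b)⁻¹)) ^ 2 = ∑ u, ∑ v, f u * f v * (f (a + c * (u - b)⁻¹) * f (a + c * (v - b)⁻¹)) := by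
      intro c a
      rw [sq, Finset.sum_mul_sum]
      refine Finset.sum_congr rfl fun u _ => Finset.sum_congr rfl fun v _ => ?_
      ring
    simp_rw [e1]
    have e2 : ∑ c : F, ∑ a : F, ∑ u, ∑ v, f u * f v * (f (a + c * (u - b)⁻¹) * f (a + c * (v - b)⁻¹))
        = ∑ u, ∑ v, f u * f v * ∑ c : F, ∑ a : F, (f (a + c * (u - b)⁻¹) * f (a + c * (v - b)⁻¹)) := by
      simp_rw [Finset.mul_sum]
      rw [Finset.sum_congr rfl fun c _ => Finset.sum_comm]
      rw [Finset.sum_comm]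
      refine Finset.sum_congr rfl fun u _ => ?_
      rw [Finset.sum_congr rfl fun c _ => Finset.sum_comm]
      rw [Finset.sum_comm]
    rw [e2]
    have e3 : ∀ u, ∑ v, f u * f v * ∑ c : F, ∑ a : F, (f (a + c * (u - b)⁻¹) * f (a + c * (v - b)⁻¹)) = f u ^ 2 * (Fintype.card F * ∑ u, f u ^ 2) := by
      intro u
      rw [Finset.sum_eq_single u]
      · rw [corr_diag]; ring
      · intro v _ hv
        rw [corr_zero f hf, mul_zero]
        intro h
        apply hv
        have := inv_injective h
        exact (sub_left_injective this).symm
      · simp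
    simp_rw [e3]
    rw [← Finset.sum_mul]; ring
  simp_rw [h1]
  simp; ring

/-- Balanced indicator. -/
noncomputable def bal (S : Finset F) (u : F) : ℝ := (if u ∈ S then 1 else 0) - (S.card : ℝ) / Fintype.card F

theorem card_pos_real : (0:ℝ) < Fintype.card F := by exact_mod_cast Fintype.card_pos

theorem bal_sum (S : Finset F) : ∑ u, bal S u = 0 := by
  have := card_pos_real (F := F)
  simp only [bal, Finset.sum_sub_distrib, Finset.sum_ite_mem, Finset.univ_inter, Finset.sum_const, Finset.card_univ, nsmul_eq_mul]
  field_simp; ring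

theorem bal_sq (S : Finset F) : ∑ u, bal S u ^ 2 ≤ S.card := by
  have := card_pos_real (F := F)
  have h : ∀ u, bal S u ^ 2 = (if u ∈ S then 1 else 0) - (S.card : ℝ) / Fintype.card F * (if u ∈ S then 1 else 0) - (S.card : ℝ) / Fintype.card F * bal S u := by
    intro u; unfold bal; split_ifs <;> ring
  simp_rw [h]
  rw [Finset.sum_sub_distrib, ← Finset.mul_sum, bal_sum, Finset.sum_sub_distrib, ← Finset.mul_sum]
  simp only [Finset.sum_ite_mem, Finset.univ_inter, Finset.sum_const, nsmul_eq_mul]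
  have : (0:ℝ) ≤ (S.card : ℝ) / Fintype.card F * (S.card * 1) := by positivity
  linarith

theorem bal_abs (S : Finset F) (u : F) : |bal S u| ≤ 1 := by
  have := card_pos_real (F := F)
  have h1 : (S.card : ℝ) / Fintype.card F ≤ 1 := by
    rw [div_le_one this]; exact_mod_cast Finset.card_le_univ S
  have h0 : 0 ≤ (S.card : ℝ) / Fintype.card F := by positivity
  unfold bal
  rw [abs_le]
  split_ifs <;> constructor <;> linarith

/-- The map attached to parameters. -/
def mob (a b c u : F) : F := a + c * (u - b)⁻¹

theorem mob_bij (a b c : F) (hc : c ≠ 0) : Function.Bijective (mob a b c) := by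
  apply Function.Injective.bijective_of_finite
  intro u v h
  simp only [mob] at h
  exact sub_left_injective (inv_injective (mul_left_cancel₀ hc (add_left_cancel h)))

theorem bal_corr (S : Finset F) (a b c : F) (hc : c ≠ 0) :
    ∑ u, bal S u * bal S (mob a b c u) = ((S.filter fun u => mob a b c u ∈ S).card : ℝ) - (S.card : ℝ) ^ 2 / Fintype.card F := by
  have := card_pos_real (F := F)
  set t : ℝ := (S.card : ℝ) / Fintype.card F with ht
  have h1 : ∑ u, bal S (mob a b c u) = 0 := by
    rw [Function.Bijective.sum_comp (mob_bij a b c hc) (bal S), bal_sum]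
  have h2 : ∀ u, bal S u * bal S (mob a b c u) = (if u ∈ S then (if mob a b c u ∈ S then 1 else 0) else 0) - (if u ∈ S then t else 0)
      - t * bal S (mob a b c u) := by
    intro u
    rw [show bal S u = (if u ∈ S then 1 else 0) - t from rfl]
    rw [show bal S (mob a b c u) = (if mob a b c u ∈ S then 1 else 0) - t from rfl]
    split_ifs <;> ring
  simp_rw [h2]
  rw [Finset.sum_sub_distrib, ← Finset.mul_sum, h1, Finset.sum_sub_distrib]
  simp only [Finset.sum_ite_mem, Finset.univ_inter, Finset.sum_const, nsmul_eq_mul, Finset.card_filter]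
  rw [ht]; push_cast; ring

/-- Points of S mapped into S. -/
def iSet (S : Finset F) (a b c : F) : Finset F := S.filter fun x => x ≠ b ∧ mob a b c x ∈ S

theorem three_points (a b c a' b' c' x1 x2 x3 y1 y2 y3 : F) (hc : c ≠ 0)
    (h12 : x1 ≠ x2) (h13 : x1 ≠ x3) (h23 : x2 ≠ x3)
    (e1 : (y1 - a) * (x1 - b) = c) (e2 : (y2 - a) * (x2 - b) = c) (e3 : (y3 - a) * (x3 - b) = c)
    (f1 : (y1 - a') * (x1 - b') = c') (f2 : (y2 - a') * (x2 - b') = c') (f3 : (y3 - a') * (x3 - b') = c') :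
    a = a' ∧ b = b' ∧ c = c' := by
  have hD : ((y1 - y2) * (x1 - x3) - (y1 - y3) * (x1 - x2)) * ((x1 - b) * (x2 - b) * (x3 - b)) = c * (x2 - x1) * (x1 - x3) * (x3 - x2) := by
    linear_combination (x2 - b) * (x3 - b) * (x2 - x3) * e1 + (x1 - b) * (x3 - b) * (x3 - x1) * e2 + (x1 - b) * (x2 - b) * (x1 - x2) * e3
  have hD0 : (y1 - y2) * (x1 - x3) - (y1 - y3) * (x1 - x2) ≠ 0 := by
    intro h
    rw [h, zero_mul] at hD
    have : c * (x2 - x1) * (x1 - x3) * (x3 - x2) ≠ 0 := by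
      refine mul_ne_zero (mul_ne_zero (mul_ne_zero hc ?_) ?_) ?_ <;> rw [sub_ne_zero] <;> tauto
    exact this hD.symm
  have hb : b = b' := by
    have : ((y1 - y2) * (x1 - x3) - (y1 - y3) * (x1 - x2)) * (b - b') = 0 := by
      linear_combination (x1 - x3) * (e2 - e1 + f1 - f2) - (x1 - x2) * (e3 - e1 + f1 - f3)
    rcases mul_eq_zero.1 this with h | h
    · exact absurd h hD0
    · exact sub_eq_zero.1 h
  subst hb
  have ha : a = a' := by
    have : (x1 - x2) * (a - a') = 0 := by linear_combination e2 - e1 + f1 - f2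
    rcases mul_eq_zero.1 this with h | h
    · exact absurd (sub_eq_zero.1 h) h12
    · exact sub_eq_zero.1 h
  subst ha
  exact ⟨rfl, rfl, e1.symm.trans f1⟩

/-- Distinct triples. -/
def dTrip (I : Finset F) : Finset (F × F × F) :=
  (I ×ˢ I ×ˢ I).filter fun x => x.1 ≠ x.2.1 ∧ x.1 ≠ x.2.2 ∧ x.2.1 ≠ x.2.2

theorem cube_le (I : Finset F) : I.card ^ 3 ≤ (dTrip I).card + 3 * I.card ^ 2 := by
  have h : I ×ˢ I ×ˢ I ⊆ dTrip I ∪ ((I ×ˢ I).image (fun x => (x.1, x.1, x.2)) ∪ ((I ×ˢ I).image (fun x => (x.1, x.2, x.1)) ∪ (I ×ˢ I).image (fun x => (x.2, x.1, x.1)))) := by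
    rintro ⟨x, y, z⟩ h
    simp only [dTrip, Finset.mem_product, Finset.mem_union, Finset.mem_filter, Finset.mem_image, Prod.exists, Prod.mk.injEq] at h ⊢
    by_cases h1 : x = y
    · subst h1; right; left; exact ⟨x, z, ⟨h.1, h.2.2⟩, rfl, rfl, rfl⟩
    by_cases h2 : x = z
    · subst h2; right; right; left; exact ⟨x, y, ⟨h.1, h.2.1⟩, rfl, rfl, rfl⟩
    by_cases h3 : y = z
    · subst h3; right; right; right; exact ⟨y, x, ⟨h.2.1, h.1⟩, rfl, rfl, rfl⟩
    left; exact ⟨h, h1, h2, h3⟩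
  have h2 := Finset.card_le_card h
  have c1 : (I ×ˢ I).card = I.card ^ 2 := by rw [Finset.card_product, sq]
  have c2 : (I ×ˢ I ×ˢ I).card = I.card ^ 3 := by simp only [Finset.card_product]; ring
  rw [c2] at h2
  refine h2.trans ((Finset.card_union_le _ _).trans ?_)
  have i1 := Finset.card_image_le (s := I ×ˢ I) (f := fun x : F × F => (x.1, x.1, x.2))
  have i2 := Finset.card_image_le (s := I ×ˢ I) (f := fun x : F × F => (x.1, x.2, x.1))
  have i3 := Finset.card_image_le (s := I ×ˢ I) (f := fun x : F × F => (x.2, x.1, x.1))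
  rw [c1] at i1 i2 i3
  have u1 := Finset.card_union_le ((I ×ˢ I).image (fun x : F × F => (x.1, x.1, x.2))) ((I ×ˢ I).image (fun x => (x.1, x.2, x.1)) ∪ (I ×ˢ I).image (fun x => (x.2, x.1, x.1)))
  have u2 := Finset.card_union_le ((I ×ˢ I).image (fun x : F × F => (x.1, x.2, x.1))) ((I ×ˢ I).image (fun x => (x.2, x.1, x.1)))
  omega

theorem third_aux (S : Finset F) :
    ∑ g ∈ (univ : Finset (F × F × F)).filter (fun g => g.2.2 ≠ 0), (dTrip (iSet S g.1 g.2.1 g.2.2)).card ≤ S.card ^ 6 := by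
  rw [← Finset.card_sigma]
  have : S.card ^ 6 = ((S ×ˢ S ×ˢ S) ×ˢ (S ×ˢ S ×ˢ S)).card := by
    simp only [Finset.card_product]; ring
  rw [this]
  apply Finset.card_le_card_of_injOn (fun w => (w.2, (mob w.1.1 w.1.2.1 w.1.2.2 w.2.1, mob w.1.1 w.1.2.1 w.1.2.2 w.2.2.1, mob w.1.1 w.1.2.1 w.1.2.2 w.2.2.2)))
  · rintro ⟨⟨a, b, c⟩, x, y, z⟩ hw
    simp only [Finset.mem_coe, Finset.mem_sigma, dTrip, iSet, Finset.mem_filter, Finset.mem_product] at hw ⊢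
    tauto
  · rintro ⟨⟨a, b, c⟩, x, y, z⟩ hw ⟨⟨a', b', c'⟩, x', y', z'⟩ hw' h
    simp only [Finset.mem_coe, Finset.mem_sigma, dTrip, iSet, Finset.mem_filter, Finset.mem_product] at hw hw'
    simp only [Prod.mk.injEq] at h
    obtain ⟨⟨rfl, rfl, rfl⟩, h1, h2, h3⟩ := h
    have key : ∀ a b c x : F, x ≠ b → (mob a b c x - a) * (x - b) = c := by
      intro a b c x hx
      have : x - b ≠ 0 := sub_ne_zero.2 hx
      simp only [mob]; field_simp; ring
    obtain ⟨⟨-, hc⟩, ⟨hx, hy, hz⟩, n1, n2, n3⟩ := hw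
    obtain ⟨⟨-, hc'⟩, ⟨hx', hy', hz'⟩, -⟩ := hw'
    have k1 := key a b c x hx.2.1
    have k2 := key a b c y hy.2.1
    have k3 := key a b c z hz.2.1
    have l1 := key a' b' c' x hx'.2.1
    have l2 := key a' b' c' y hy'.2.1
    have l3 := key a' b' c' z hz'.2.1
    rw [← h1] at l1
    rw [← h2] at l2
    rw [← h3] at l3
    obtain ⟨rfl, rfl, rfl⟩ := three_points a b c a' b' c' x y z _ _ _ hc n1 n2 n3 k1 k2 k3 l1 l2 l3
    rfl

theorem third_moment (S : Finset F) :
    ∑ g ∈ (univ : Finset (F × F × F)).filter (fun g => g.2.2 ≠ 0),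
      (if 4 ≤ (iSet S g.1 g.2.1 g.2.2).card then (iSet S g.1 g.2.1 g.2.2).card ^ 3 else 0) ≤ 4 * S.card ^ 6 := by
  refine le_trans ?_ (Nat.mul_le_mul_left 4 (third_aux S))
  rw [Finset.mul_sum]
  refine Finset.sum_le_sum fun g _ => ?_
  split_ifs with h
  · have := cube_le (iSet S g.1 g.2.1 g.2.2)
    set i := (iSet S g.1 g.2.1 g.2.2).card
    nlinarith [Nat.mul_le_mul_right (i ^ 2) h, pow_succ i 2]
  · exact Nat.zero_le _

end Moments

section Push

/-- Collision count. -/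
def coll {ω γ : Type*} [DecidableEq γ] (W : Finset ω) (P : ω → γ) : ℕ :=
  ((W ×ˢ W).filter fun x => P x.1 = P x.2).card

theorem push_sum {ω γ : Type*} [DecidableEq γ] (W : Finset ω) (P : ω → γ) (G : Finset γ) (hP : ∀ w ∈ W, P w ∈ G)
    (φ : γ → ℝ) : ∑ w ∈ W, φ (P w) = ∑ g ∈ G, ((W.filter fun w => P w = g).card : ℝ) * φ g := by
  rw [← Finset.sum_fiberwise_of_maps_to hP]
  refine Finset.sum_congr rfl fun g _ => ?_
  rw [Finset.sum_congr rfl (g := fun _ => φ g)]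
  · simp
  · intro w hw; rw [(Finset.mem_filter.1 hw).2]

theorem push_one {ω γ : Type*} [DecidableEq γ] (W : Finset ω) (P : ω → γ) (G : Finset γ) (hP : ∀ w ∈ W, P w ∈ G) :
    ∑ g ∈ G, ((W.filter fun w => P w = g).card : ℝ) = W.card := by
  have := push_sum W P G hP (fun _ => 1)
  simp at this
  exact this.symm

theorem push_coll {ω γ : Type*} [DecidableEq γ] (W : Finset ω) (P : ω → γ) (G : Finset γ) (hP : ∀ w ∈ W, P w ∈ G) :
    ∑ g ∈ G, ((W.filter fun w => P w = g).card : ℝ) ^ 2 = coll W P := by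
  have h := push_sum W P G hP (fun g => ((W.filter fun w => P w = g).card : ℝ))
  have h2 : (coll W P : ℝ) = ∑ w ∈ W, ((W.filter fun v => P v = P w).card : ℝ) := by
    unfold coll
    rw [Finset.card_filter, Finset.sum_product]
    push_cast
    refine Finset.sum_congr rfl fun w _ => ?_
    rw [Finset.card_filter]
    push_cast
    refine Finset.sum_congr rfl fun v _ => ?_
    simp only [eq_comm]
  rw [h2, h]
  refine Finset.sum_congr rfl fun g _ => ?_
  ring

theorem amgm3 (a b d : ℝ) (ha : 0 ≤ a) (hb : 0 ≤ b) (hd : 0 ≤ d) : a * b * d ≤ ((a + b + d) / 3) ^ 3 := by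
  nlinarith [mul_nonneg ha (sq_nonneg (b - d)), mul_nonneg hb (sq_nonneg (a - d)), mul_nonneg hd (sq_nonneg (a - b)),
    mul_nonneg (add_nonneg (add_nonneg ha hb) hd) (add_nonneg (add_nonneg (sq_nonneg (a - b)) (sq_nonneg (b - d))) (sq_nonneg (a - d)))]

theorem holder3 {γ : Type*} (G : Finset γ) (n I : γ → ℝ) (hn : ∀ g ∈ G, 0 ≤ n g) (hI : ∀ g ∈ G, 0 ≤ I g) :
    (∑ g ∈ G, n g * I g) ^ 3 ≤ (∑ g ∈ G, n g) * (∑ g ∈ G, n g ^ 2) * ∑ g ∈ G, I g ^ 3 := by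
  have hX := Finset.sum_nonneg hn
  have hY := Finset.sum_nonneg (s := G) (f := fun g => n g ^ 2) fun g hg => sq_nonneg (n g)
  have hZ := Finset.sum_nonneg (s := G) (f := fun g => I g ^ 3) fun g hg => pow_nonneg (hI g hg) 3
  set X := ∑ g ∈ G, n g with hXd
  set Y := ∑ g ∈ G, n g ^ 2 with hYd
  set Z := ∑ g ∈ G, I g ^ 3 with hZd
  by_cases h0 : ∀ g ∈ G, n g * I g = 0
  · rw [Finset.sum_eq_zero h0]; simp; positivity
  push Not at h0
  obtain ⟨g, hg, hne⟩ := h0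
  have hn0 : 0 < n g := lt_of_le_of_ne (hn g hg) (Ne.symm (left_ne_zero_of_mul hne))
  have hI0 : 0 < I g := lt_of_le_of_ne (hI g hg) (Ne.symm (right_ne_zero_of_mul hne))
  have hX0 : 0 < X := Finset.sum_pos' hn ⟨g, hg, hn0⟩
  have hY0 : 0 < Y := Finset.sum_pos' (fun g hg => sq_nonneg (n g)) ⟨g, hg, by positivity⟩
  have hZ0 : 0 < Z := Finset.sum_pos' (fun g hg => pow_nonneg (hI g hg) 3) ⟨g, hg, by positivity⟩
  obtain ⟨c, hc0, hc⟩ : ∃ c : ℝ, 0 < c ∧ c ^ 3 = X * Y * Z := by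
    refine ⟨(X * Y * Z) ^ ((1:ℝ)/3), by positivity, ?_⟩
    rw [← Real.rpow_natCast, ← Real.rpow_mul (by positivity)]; norm_num
  have key : ∀ g ∈ G, n g * I g ≤ c * ((n g / X + n g ^ 2 / Y + I g ^ 3 / Z) / 3) := by
    intro g hg
    have a1 := hn g hg
    have a2 := hI g hg
    refine le_of_pow_le_pow_left₀ (n := 3) (by norm_num) (by positivity) ?_
    have := amgm3 (n g / X) (n g ^ 2 / Y) (I g ^ 3 / Z) (by positivity) (by positivity) (by positivity)
    rw [mul_pow c]
    calc (n g * I g) ^ 3 = c ^ 3 * (n g / X * (n g ^ 2 / Y) * (I g ^ 3 / Z)) := by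
          rw [hc]; field_simp
      _ ≤ _ := by gcongr
  have h1 := Finset.sum_le_sum key
  rw [← Finset.mul_sum, ← Finset.sum_div, Finset.sum_add_distrib, Finset.sum_add_distrib, ← Finset.sum_div, ← Finset.sum_div,
    ← Finset.sum_div, ← hXd, ← hYd, ← hZd, div_self hX0.ne', div_self hY0.ne', div_self hZ0.ne'] at h1
  have h2 : ∑ g ∈ G, n g * I g ≤ c := by linarith
  have h3 : 0 ≤ ∑ g ∈ G, n g * I g := Finset.sum_nonneg fun g hg => mul_nonneg (hn g hg) (hI g hg)
  rw [← hc]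
  exact pow_le_pow_left₀ h3 h2 3

variable {F : Type*} [Field F] [Fintype F] [DecidableEq F]

theorem two_to_one (k : F) (hk : k ≠ 0) (G : F → ℝ) (hG : ∀ c, 0 ≤ G c) :
    ∑ t ∈ univ.filter (fun t : F => t ≠ 0), G (k * (t ^ 2)⁻¹) ≤ 2 * ∑ c ∈ univ.filter (fun c : F => c ≠ 0), G c := by
  rw [push_sum (univ.filter (fun t : F => t ≠ 0)) (fun t => k * (t ^ 2)⁻¹) (univ.filter (fun t : F => t ≠ 0)) ?_ G]
  · rw [Finset.mul_sum]
    refine Finset.sum_le_sum fun c hc => ?_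
    refine mul_le_mul_of_nonneg_right ?_ (hG c)
    set fib := (univ.filter (fun t : F => t ≠ 0)).filter (fun t => k * (t ^ 2)⁻¹ = c)
    rcases fib.eq_empty_or_nonempty with h | ⟨t, ht⟩
    · rw [h]; simp
    · have : fib ⊆ {t, -t} := by
        intro u hu
        simp only [fib, Finset.mem_filter, Finset.mem_univ, true_and] at ht hu
        have h1 : (u ^ 2)⁻¹ = (t ^ 2)⁻¹ := mul_left_cancel₀ hk (hu.2.trans ht.2.symm)
        have h2 := sq_eq_sq_iff_eq_or_eq_neg.1 (inv_injective h1)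
        simpa using h2
      have h3 := (Finset.card_le_card this).trans Finset.card_le_two
      exact_mod_cast h3
  · intro t ht
    simp only [Finset.mem_filter, Finset.mem_univ, true_and] at ht ⊢
    exact mul_ne_zero hk (inv_ne_zero (pow_ne_zero 2 ht))

/-- nonzero last coordinate -/
def nzG (F : Type*) [Field F] [Fintype F] [DecidableEq F] : Finset (F × F × F) := univ.filter fun g => g.2.2 ≠ 0

theorem nzG_sum (φ : F × F × F → ℝ) : ∑ g ∈ nzG F, φ g = ∑ a, ∑ b, ∑ c ∈ univ.filter (fun c : F => c ≠ 0), φ (a, b, c) := by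
  unfold nzG
  rw [Finset.sum_filter, Fintype.sum_prod_type]
  refine Finset.sum_congr rfl fun a _ => ?_
  rw [Fintype.sum_prod_type]
  refine Finset.sum_congr rfl fun b _ => ?_
  rw [Finset.sum_filter]

theorem two_to_one' (k : F) (hk : k ≠ 0) (φ : F × F × F → ℝ) (hG : ∀ c, 0 ≤ φ c) :
    ∑ g ∈ nzG F, φ (g.1, g.2.1, k * (g.2.2 ^ 2)⁻¹) ≤ 2 * ∑ g ∈ nzG F, φ g := by
  rw [nzG_sum, nzG_sum, Finset.mul_sum]
  refine Finset.sum_le_sum fun a _ => ?_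
  rw [Finset.mul_sum]
  refine Finset.sum_le_sum fun b _ => ?_
  exact two_to_one k hk (fun c => φ (a, b, c)) fun c => hG _

/-- large part of the count -/
noncomputable def bigI (S : Finset F) (g : F × F × F) : ℝ :=
  if 4 ≤ (iSet S g.1 g.2.1 g.2.2).card then ((iSet S g.1 g.2.1 g.2.2).card : ℝ) else 0

theorem bigI_nonneg (S : Finset F) (g : F × F × F) : 0 ≤ bigI S g := by
  unfold bigI; split_ifs <;> positivity

theorem R1gen {ω : Type*} (W : Finset ω) (P : ω → F × F × F) (hP : ∀ w ∈ W, (P w).2.2 ≠ 0) (k : F) (hk : k ≠ 0) (S : Finset F) :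
    (∑ w ∈ W, bigI S ((P w).1, (P w).2.1, k * ((P w).2.2 ^ 2)⁻¹)) ^ 3 ≤ W.card * coll W P * (8 * (S.card : ℝ) ^ 6) := by
  have hP' : ∀ w ∈ W, P w ∈ nzG F := fun w hw => by simp [nzG, hP w hw]
  rw [push_sum W P (nzG F) hP' (fun g => bigI S (g.1, g.2.1, k * (g.2.2 ^ 2)⁻¹))]
  refine (holder3 _ _ _ (fun g _ => by positivity) (fun g _ => bigI_nonneg S _)).trans ?_
  rw [push_one W P _ hP', push_coll W P _ hP']
  refine mul_le_mul_of_nonneg_left ?_ (by positivity)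
  refine (two_to_one' k hk (fun g => bigI S g ^ 3) (fun g => pow_nonneg (bigI_nonneg S g) 3)).trans ?_
  have h3 := third_moment S
  have h4 : ∑ g ∈ nzG F, bigI S g ^ 3 ≤ 4 * (S.card : ℝ) ^ 6 := by
    have h5 : ((∑ g ∈ nzG F,
      (if 4 ≤ (iSet S g.1 g.2.1 g.2.2).card then (iSet S g.1 g.2.1 g.2.2).card ^ 3 else 0) : ℕ) : ℝ) ≤ ((4 * S.card ^ 6 : ℕ) : ℝ) := Nat.cast_le.2 h3
    push_cast at h5
    refine le_trans (le_of_eq ?_) h5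
    refine Finset.sum_congr rfl fun g _ => ?_
    unfold bigI
    split_ifs <;> simp
  linarith

/-- Balanced correlation. -/
noncomputable def balT (S : Finset F) (g : F × F × F) : ℝ := ∑ u, bal S u * bal S (mob g.1 g.2.1 g.2.2 u)

theorem balT_moment (S : Finset F) : ∑ g ∈ nzG F, balT S g ^ 2 ≤ (Fintype.card F : ℝ) ^ 2 * (S.card : ℝ) ^ 2 := by
  have h := second_moment (bal S) (bal_sum S)
  have h1 : ∑ g ∈ nzG F, balT S g ^ 2 ≤ ∑ g : F × F × F, balT S g ^ 2 :=
    Finset.sum_le_sum_of_subset_of_nonneg (Finset.subset_univ _) fun g _ _ => sq_nonneg _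
  have h2 : ∑ g : F × F × F, balT S g ^ 2 = ∑ b : F, ∑ c : F, ∑ a : F, (∑ u, bal S u * bal S (a + c * (u - b)⁻¹)) ^ 2 := by
    rw [Fintype.sum_prod_type]
    simp_rw [Fintype.sum_prod_type]
    rw [Finset.sum_comm]
    refine Finset.sum_congr rfl fun b _ => ?_
    rw [Finset.sum_comm]
    rfl
  rw [h2, h] at h1
  refine h1.trans ?_
  have h0 : 0 ≤ ∑ u, bal S u ^ 2 := Finset.sum_nonneg fun u _ => sq_nonneg _
  have := bal_sq S
  gcongr

theorem R2gen {ω : Type*} (W : Finset ω) (P : ω → F × F × F) (hP : ∀ w ∈ W, (P w).2.2 ≠ 0) (k : F) (hk : k ≠ 0) (S : Finset F) :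
    (∑ w ∈ W, balT S ((P w).1, (P w).2.1, k * ((P w).2.2 ^ 2)⁻¹)) ^ 2 ≤ coll W P * (2 * (Fintype.card F : ℝ) ^ 2 * (S.card : ℝ) ^ 2) := by
  have hP' : ∀ w ∈ W, P w ∈ nzG F := fun w hw => by simp [nzG, hP w hw]
  rw [push_sum W P (nzG F) hP' (fun g => balT S (g.1, g.2.1, k * (g.2.2 ^ 2)⁻¹))]
  refine (Finset.sum_mul_sq_le_sq_mul_sq _ _ _).trans ?_
  rw [push_coll W P _ hP']
  refine mul_le_mul_of_nonneg_left ?_ (by positivity)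
  refine (two_to_one' k hk (fun g => balT S g ^ 2) (fun g => sq_nonneg _)).trans ?_
  have := balT_moment S
  linarith

end Push

section Words

variable {F : Type*} [Field F] [Fintype F] [DecidableEq F]

/-- factors -/
def facS (A : Finset F) (lam : F) : Finset F := A.filter fun b => b ≠ 0 ∧ lam * b⁻¹ ∈ A

/-- middle letters -/
def midS (A : Finset F) (lam : F) (x : F × F) : Finset F :=
  (facS A lam).filter fun b => x.1 - b ∈ facS A lam ∧ x.2 - lam * b⁻¹ ∈ facS A lam

/-- good words -/
def wordS (A : Finset F) (lam : F) : Finset ((F × F) × (F × F)) :=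
  (((A + A) ×ˢ (A + A)).filter fun x => x.1 * x.2 ≠ lam) ×ˢ (A ×ˢ A)

/-- parameters of a word -/
def parS (lam : F) (w : (F × F) × (F × F)) : F × F × F :=
  (w.2.2 + lam * w.1.1 * (w.1.1 * w.1.2 - lam)⁻¹, w.2.1 + lam * w.1.2 * (w.1.1 * w.1.2 - lam)⁻¹, w.1.1 * w.1.2 - lam)

theorem mid_le (A : Finset F) (lam : F) (hl : lam ≠ 0) (w) (hw : w ∈ wordS A lam) :
    (midS A lam w.1).card ≤ (iSet (A + A) (parS lam w).1 (parS lam w).2.1 (lam ^ 3 * ((parS lam w).2.2 ^ 2)⁻¹)).card := by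
  obtain ⟨⟨s, s'⟩, a, a'⟩ := w
  simp only [wordS, Finset.mem_product, Finset.mem_filter] at hw
  obtain ⟨⟨-, hne⟩, ha, ha'⟩ := hw
  have ht : s * s' - lam ≠ 0 := sub_ne_zero.2 hne
  apply Finset.card_le_card_of_injOn (fun b => a + lam * (s - b)⁻¹)
  · intro b hb
    simp only [midS, facS, Finset.mem_coe, Finset.mem_filter] at hb
    obtain ⟨⟨hbA, hb0, hbl⟩, ⟨h1A, h10, h1l⟩, h3A, h30, h3l⟩ := hb
    have key : (a + lam * (s - b)⁻¹ - (a + lam * s' * (s * s' - lam)⁻¹)) = lam * b * (s' - lam * b⁻¹) * (s - b)⁻¹ * (s * s' - lam)⁻¹ := by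
      field_simp
      ring
    have hk0 : lam * b * (s' - lam * b⁻¹) * (s - b)⁻¹ * (s * s' - lam)⁻¹ ≠ 0 := by
      refine mul_ne_zero (mul_ne_zero (mul_ne_zero (mul_ne_zero hl hb0) h30) (inv_ne_zero h10)) (inv_ne_zero ht)
    refine Finset.mem_coe.2 (Finset.mem_filter.2 ⟨Finset.add_mem_add ha h1l, ?_, ?_⟩)
    · intro h
      simp only [parS] at h
      rw [h, sub_self] at key
      exact hk0 key.symm
    · have : mob (a' + lam * s * (s * s' - lam)⁻¹) (a + lam * s' * (s * s' - lam)⁻¹) (lam ^ 3 * ((s * s' - lam) ^ 2)⁻¹) (a + lam * (s - b)⁻¹) = a' + lam * (s' - lam * b⁻¹)⁻¹ := by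
        unfold mob
        rw [key]
        set u := s - b with hu
        set v := s' - lam * b⁻¹ with hv
        have hsu : s = u + b := by rw [hu]; ring
        have hsv : s' * b = v * b + lam := by rw [hv]; field_simp; ring
        have : (lam * b * v * u⁻¹ * (s * s' - lam)⁻¹)⁻¹ = u * (s * s' - lam) * (lam * b * v)⁻¹ := by
          simp only [mul_inv, inv_inv]; ring
        rw [this]
        have e : s * b * v + lam * u = b * (s * s' - lam) := by
          have : s * (s' * b) = s * (v * b + lam) := by rw [hsv]
          linear_combination (-1 : F) * this - lam * hsu
        have e2 : lam * s * (s * s' - lam)⁻¹ + lam ^ 3 * ((s * s' - lam) ^ 2)⁻¹ * (u * (s * s' - lam) * (lam * b * v)⁻¹) = lam * v⁻¹ := by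
          set τ := s * s' - lam
          field_simp
          linear_combination e
        linear_combination e2
      simp only [parS]
      rw [this]
      exact Finset.add_mem_add ha' h3l
  · intro b hb b' hb' h
    have := mul_left_cancel₀ hl (add_left_cancel h)
    exact sub_right_injective (inv_injective this)

theorem sum_mid (A : Finset F) (lam : F) (hl : lam ≠ 0) :
    (facS A lam).card ^ 3 ≤ ∑ x ∈ (A + A) ×ˢ (A + A), (midS A lam x).card := by
  rw [← Finset.card_sigma]
  have : (facS A lam).card ^ 3 = (facS A lam ×ˢ facS A lam ×ˢ facS A lam).card := by
    simp only [Finset.card_product]; ring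
  rw [this]
  apply Finset.card_le_card_of_injOn (fun y => ⟨(y.1 + y.2.1, y.2.2 + lam * y.2.1⁻¹), y.2.1⟩)
  · rintro ⟨b1, b, b3⟩ hb
    simp only [Finset.mem_coe, Finset.mem_product, Finset.mem_sigma, midS, Finset.mem_filter, add_sub_cancel_right] at hb ⊢
    refine ⟨⟨Finset.add_mem_add (Finset.mem_filter.1 hb.1).1 (Finset.mem_filter.1 hb.2.1).1, Finset.add_mem_add (Finset.mem_filter.1 hb.2.2).1 (Finset.mem_filter.1 hb.2.1).2.2⟩, hb.2.1, hb.1, hb.2.2⟩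
  · rintro ⟨b1, b, b3⟩ - ⟨c1, c, c3⟩ - h
    simp only [Sigma.mk.injEq, Prod.mk.injEq, heq_eq_eq] at h
    obtain ⟨⟨h1, h2⟩, rfl⟩ := h
    rw [add_right_cancel h1, add_right_cancel h2]

theorem bad_mid (A : Finset F) (lam : F) (hl : lam ≠ 0) :
    ∑ x ∈ ((A + A) ×ˢ (A + A)).filter (fun x => x.1 * x.2 = lam), (midS A lam x).card ≤ (A + A).card * (facS A lam).card := by
  refine (Finset.sum_le_card_nsmul _ _ (facS A lam).card fun x _ => Finset.card_filter_le _ _).trans ?_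
  rw [smul_eq_mul]
  refine Nat.mul_le_mul_right _ ?_
  apply Finset.card_le_card_of_injOn (fun x => x.1)
  · intro x hx
    simp only [Finset.mem_coe, Finset.mem_filter, Finset.mem_product] at hx ⊢
    exact hx.1.1
  · rintro ⟨x, y⟩ hx ⟨x', y'⟩ hx' h
    simp only [Finset.mem_coe, Finset.mem_filter] at hx hx' h
    subst h
    have hx0 : x ≠ 0 := by
      rintro rfl; rw [zero_mul] at hx; exact hl hx.2.symm
    rw [mul_left_cancel₀ hx0 (hx.2.trans hx'.2.symm)]

theorem coll_words (A : Finset F) (lam : F) : coll (wordS A lam) (parS lam) ≤ mulEn (A + A) * A.card ^ 2 := by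
  have : mulEn (A + A) * A.card ^ 2 = ((((A + A) ×ˢ (A + A)) ×ˢ ((A + A) ×ˢ (A + A))).filter (fun w => w.1.1 * w.1.2 = w.2.1 * w.2.2) ×ˢ (A ×ˢ A)).card := by
    rw [Finset.card_product, Finset.card_product, sq]; rfl
  rw [this]
  unfold coll
  apply Finset.card_le_card_of_injOn (fun x => ((x.1.1, x.2.1), x.1.2))
  · rintro ⟨⟨⟨s, s'⟩, a, a'⟩, ⟨t, t'⟩, b, b'⟩ h
    simp only [wordS, parS, Finset.mem_coe, Finset.mem_filter, Finset.mem_product, Prod.mk.injEq, sub_left_inj] at h ⊢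
    tauto
  · rintro ⟨⟨⟨s, s'⟩, a, a'⟩, ⟨t, t'⟩, b, b'⟩ h ⟨⟨⟨s1, s1'⟩, a1, a1'⟩, ⟨t1, t1'⟩, b1, b1'⟩ h1 e
    simp only [Prod.mk.injEq] at e
    obtain ⟨⟨⟨rfl, rfl⟩, rfl, rfl⟩, rfl, rfl⟩ := e
    simp only [parS, Finset.mem_coe, Finset.mem_filter, Prod.mk.injEq] at h h1
    have e1 := h.2.1.symm.trans h1.2.1
    have e2 := h.2.2.1.symm.trans h1.2.2.1
    rw [add_right_cancel e1, add_right_cancel e2]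

theorem word_card (A : Finset F) (lam : F) : ((wordS A lam).card : ℝ) ≤ ((A + A).card : ℝ) ^ 2 * (A.card : ℝ) ^ 2 := by
  have : (wordS A lam).card ≤ (A + A).card ^ 2 * A.card ^ 2 := by
    unfold wordS
    rw [Finset.card_product, Finset.card_product, ← sq]
    refine Nat.mul_le_mul_right _ ((Finset.card_filter_le _ _).trans ?_)
    rw [Finset.card_product, sq]
  exact_mod_cast this

theorem word_sum (A : Finset F) (lam : F) (hl : lam ≠ 0) :
    (A.card : ℝ) ^ 2 * ((facS A lam).card : ℝ) ^ 3 ≤ (A.card : ℝ) ^ 2 * ((A + A).card * (facS A lam).card) + ∑ w ∈ wordS A lam, ((midS A lam w.1).card : ℝ) := by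
  have h1 := sum_mid A lam hl
  have h2 := bad_mid A lam hl
  rw [← Finset.sum_filter_add_sum_filter_not _ (fun x : F × F => x.1 * x.2 = lam)] at h1
  have h3 : ∑ w ∈ wordS A lam, (midS A lam w.1).card = A.card ^ 2 * ∑ x ∈ ((A + A) ×ˢ (A + A)).filter (fun x => ¬ x.1 * x.2 = lam), (midS A lam x).card := by
    unfold wordS
    rw [Finset.sum_product, Finset.mul_sum]
    refine Finset.sum_congr rfl fun x _ => ?_
    simp only [Finset.sum_const, Finset.card_product, smul_eq_mul]
    ring
  have h4 : A.card ^ 2 * (facS A lam).card ^ 3 ≤ A.card ^ 2 * ((A + A).card * (facS A lam).card) + ∑ w ∈ wordS A lam, (midS A lam w.1).card := by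
    rw [h3, ← mul_add]
    exact Nat.mul_le_mul_left _ (by omega)
  exact_mod_cast h4

theorem par_ne (A : Finset F) (lam : F) (w) (hw : w ∈ wordS A lam) : (parS lam w).2.2 ≠ 0 := by
  simp only [wordS, Finset.mem_product, Finset.mem_filter] at hw
  exact sub_ne_zero.2 hw.1.2

theorem R1 (A : Finset F) (lam : F) (hl : lam ≠ 0) : ∃ T : ℝ,
    (A.card : ℝ) ^ 2 * ((facS A lam).card : ℝ) ^ 3 ≤ (A.card : ℝ) ^ 2 * ((A + A).card * (facS A lam).card) +
      3 * (((A + A).card : ℝ) ^ 2 * (A.card : ℝ) ^ 2) + T ∧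
    T ^ 3 ≤ (((A + A).card : ℝ) ^ 2 * (A.card : ℝ) ^ 2) * (mulEn (A + A) * (A.card : ℝ) ^ 2) * (8 * ((A + A).card : ℝ) ^ 6) := by
  refine ⟨_, ?_, (R1gen (wordS A lam) (parS lam) (par_ne A lam) (lam ^ 3) (pow_ne_zero 3 hl) (A + A)).trans ?_⟩
  · refine (word_sum A lam hl).trans ?_
    rw [add_assoc]
    refine add_le_add_right ?_ _
    have : ∑ w ∈ wordS A lam, ((midS A lam w.1).card : ℝ) ≤ ∑ w ∈ wordS A lam, (3 + bigI (A + A) ((parS lam w).1, (parS lam w).2.1, lam ^ 3 * ((parS lam w).2.2 ^ 2)⁻¹)) := by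
      refine Finset.sum_le_sum fun w hw => ?_
      have h := mid_le A lam hl w hw
      have h' : ((midS A lam w.1).card : ℝ) ≤ _ := Nat.cast_le.2 h
      refine h'.trans ?_
      unfold bigI
      split_ifs with h4
      · simp only; linarith
      · push Not at h4
        simp only at h4
        rw [add_zero]
        exact_mod_cast Nat.lt_succ_iff.1 h4
    refine this.trans ?_
    rw [Finset.sum_add_distrib, Finset.sum_const, nsmul_eq_mul]
    have := word_card A lam
    linarith
  · have h1 := word_card A lam
    have h2 : (coll (wordS A lam) (parS lam) : ℝ) ≤ mulEn (A + A) * (A.card : ℝ) ^ 2 := by exact_mod_cast coll_words A lam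
    gcongr

theorem R2 (A : Finset F) (lam : F) (hl : lam ≠ 0) : ∃ U : ℝ,
    (A.card : ℝ) ^ 2 * ((facS A lam).card : ℝ) ^ 3 ≤ (A.card : ℝ) ^ 2 * ((A + A).card * (facS A lam).card) +
      (((A + A).card : ℝ) ^ 2 * (A.card : ℝ) ^ 2) * (((A + A).card : ℝ) ^ 2 / Fintype.card F) + U ∧
    U ^ 2 ≤ (mulEn (A + A) * (A.card : ℝ) ^ 2) * (2 * (Fintype.card F : ℝ) ^ 2 * ((A + A).card : ℝ) ^ 2) := by
  refine ⟨_, ?_, (R2gen (wordS A lam) (parS lam) (par_ne A lam) (lam ^ 3) (pow_ne_zero 3 hl) (A + A)).trans ?_⟩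
  · refine (word_sum A lam hl).trans ?_
    rw [add_assoc]
    refine add_le_add_right ?_ _
    have : ∑ w ∈ wordS A lam, ((midS A lam w.1).card : ℝ) ≤ ∑ w ∈ wordS A lam, (((A + A).card : ℝ) ^ 2 / Fintype.card F + balT (A + A) ((parS lam w).1, (parS lam w).2.1, lam ^ 3 * ((parS lam w).2.2 ^ 2)⁻¹)) := by
      refine Finset.sum_le_sum fun w hw => ?_
      have h := mid_le A lam hl w hw
      have h2 := h.trans (Finset.card_le_card (t := (A + A).filter fun u => mob (parS lam w).1 (parS lam w).2.1 (lam ^ 3 * ((parS lam w).2.2 ^ 2)⁻¹) u ∈ A + A) (by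
        intro x hx
        simp only [iSet, Finset.mem_filter] at hx ⊢
        exact ⟨hx.1, hx.2.2⟩))
      have h' : ((midS A lam w.1).card : ℝ) ≤ _ := Nat.cast_le.2 h2
      refine h'.trans ?_
      unfold balT
      have h5 := bal_corr (A + A) (parS lam w).1 (parS lam w).2.1 (lam ^ 3 * ((parS lam w).2.2 ^ 2)⁻¹)
        (mul_ne_zero (pow_ne_zero 3 hl) (inv_ne_zero (pow_ne_zero 2 (par_ne A lam w hw))))
      simp only
      rw [h5]
      linarith
    refine this.trans ?_
    rw [Finset.sum_add_distrib, Finset.sum_const, nsmul_eq_mul]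
    have := word_card A lam
    gcongr
  · have h2 : (coll (wordS A lam) (parS lam) : ℝ) ≤ mulEn (A + A) * (A.card : ℝ) ^ 2 := by exact_mod_cast coll_words A lam
    gcongr

end Words

section Two

variable {F : Type*} [Field F] [Fintype F] [DecidableEq F]

theorem mob_inv (a b c v : F) (hc : c ≠ 0) : mob b a c (mob a b c v) = v := by
  simp only [mob, add_sub_cancel_left, mul_inv, inv_inv, mul_inv_cancel_left₀ hc]
  ring

theorem mob_comp (a b a' b' lam v : F) (hl : lam ≠ 0) (hd : a - a' ≠ 0) (h1 : v ≠ b) (h2 : v ≠ b - lam * (a - a')⁻¹) :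
    mob b' a' lam (mob a b lam v) = mob (b' + lam * (a - a')⁻¹) (b - lam * (a - a')⁻¹) (-lam ^ 2 * ((a - a') ^ 2)⁻¹) v := by
  unfold mob
  set d := a - a' with hdd
  have e1 : v - b ≠ 0 := sub_ne_zero.2 h1
  set z := v - b with hz
  have e2 : v - (b - lam * d⁻¹) ≠ 0 := sub_ne_zero.2 h2
  have e3 : v - (b - lam * d⁻¹) = (d * z + lam) * d⁻¹ := by
    have : v - (b - lam * d⁻¹) = z + lam * d⁻¹ := by rw [hz]; ring
    rw [this]; field_simp
  have e4 : d * z + lam ≠ 0 := by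
    intro h; rw [h, zero_mul] at e3; exact e2 e3
  have e5 : a + lam * z⁻¹ - a' = (d * z + lam) * z⁻¹ := by
    have : a + lam * z⁻¹ - a' = d + lam * z⁻¹ := by rw [hdd]; ring
    rw [this]; field_simp
  rw [e3, e5, mul_inv, mul_inv, inv_inv, inv_inv]
  set q := d * z + lam with hq
  have : lam * (q⁻¹ * z) = lam * d⁻¹ + -lam ^ 2 * (d ^ 2)⁻¹ * (q⁻¹ * d) := by
    field_simp
    rw [hq]; ring
  rw [this]; ring

theorem corr_same (S : Finset F) (a b a' b' lam : F) (hl : lam ≠ 0) :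
    ∑ x, bal S (mob b a lam x) * bal S (mob b' a' lam x) ≤ S.card := by
  have h1 : ∀ x, bal S (mob b a lam x) * bal S (mob b' a' lam x) ≤ bal S (mob b a lam x) ^ 2 / 2 + bal S (mob b' a' lam x) ^ 2 / 2 := by
    intro x; nlinarith [sq_nonneg (bal S (mob b a lam x) - bal S (mob b' a' lam x))]
  refine (Finset.sum_le_sum fun x _ => h1 x).trans ?_
  rw [Finset.sum_add_distrib, ← Finset.sum_div, ← Finset.sum_div,
    Function.Bijective.sum_comp (mob_bij b a lam hl) (fun u => bal S u ^ 2),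
    Function.Bijective.sum_comp (mob_bij b' a' lam hl) (fun u => bal S u ^ 2)]
  have := bal_sq S
  linarith

theorem corr_diff (S : Finset F) (a b a' b' lam : F) (hl : lam ≠ 0) (hd : a - a' ≠ 0) :
    ∑ x, bal S (mob b a lam x) * bal S (mob b' a' lam x) ≤ 4 +
      balT S (b' + lam * (a - a')⁻¹, b - lam * (a - a')⁻¹, -lam ^ 2 * ((a - a') ^ 2)⁻¹) := by
  rw [← Function.Bijective.sum_comp (mob_bij a b lam hl)]
  simp only [mob_inv a b lam _ hl]
  unfold balT
  simp only
  have h : ∀ v, bal S v * bal S (mob b' a' lam (mob a b lam v)) ≤ ((if v = b then 2 else 0) + (if v = b - lam * (a - a')⁻¹ then 2 else 0)) +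
      bal S v * bal S (mob (b' + lam * (a - a')⁻¹) (b - lam * (a - a')⁻¹) (-lam ^ 2 * ((a - a') ^ 2)⁻¹) v) := by
    intro v
    have g : ∀ x y : F, |bal S x * bal S y| ≤ 1 := by
      intro x y; rw [abs_mul]; exact mul_le_one₀ (bal_abs S x) (abs_nonneg _) (bal_abs S y)
    have g1 := abs_le.1 (g v (mob b' a' lam (mob a b lam v)))
    have g2 := abs_le.1 (g v (mob (b' + lam * (a - a')⁻¹) (b - lam * (a - a')⁻¹) (-lam ^ 2 * ((a - a') ^ 2)⁻¹) v))
    by_cases h1 : v = b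
    · rw [if_pos h1]
      have : (0:ℝ) ≤ if v = b - lam * (a - a')⁻¹ then 2 else 0 := by split_ifs <;> norm_num
      linarith [g1.2, g2.1]
    by_cases h2 : v = b - lam * (a - a')⁻¹
    · rw [if_pos h2, if_neg h1]
      linarith [g1.2, g2.1]
    rw [if_neg h1, if_neg h2, mob_comp a b a' b' lam v hl hd h1 h2]
    linarith
  refine (Finset.sum_le_sum fun v _ => h v).trans ?_
  rw [Finset.sum_add_distrib, Finset.sum_add_distrib]
  simp only [Finset.sum_ite_eq', Finset.mem_univ, if_true]
  linarith

/-- two-letter words -/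
def wordT (A : Finset F) : Finset ((F × F) × (F × F)) :=
  ((A ×ˢ A) ×ˢ (A ×ˢ A)).filter fun w => ¬ w.1.1 = w.2.1

/-- parameters -/
def parT (lam : F) (w : (F × F) × (F × F)) : F × F × F :=
  (w.2.2 + lam * (w.1.1 - w.2.1)⁻¹, w.1.2 - lam * (w.1.1 - w.2.1)⁻¹, w.1.1 - w.2.1)

theorem coll_T (A : Finset F) (lam : F) : coll (wordT A) (parT lam) ≤ A.card ^ 5 := by
  have : A.card ^ 5 = (A ×ˢ A ×ˢ A ×ˢ A ×ˢ A).card := by simp only [Finset.card_product]; ring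
  rw [this]
  unfold coll
  apply Finset.card_le_card_of_injOn (fun x => (x.1.1.1, x.1.1.2, x.1.2.1, x.1.2.2, x.2.1.1))
  · rintro ⟨⟨⟨a, b⟩, a', b'⟩, ⟨c, d⟩, c', d'⟩ h
    simp only [wordT, Finset.mem_coe, Finset.mem_filter, Finset.mem_product] at h ⊢
    tauto
  · rintro ⟨⟨⟨a, b⟩, a', b'⟩, ⟨c, d⟩, c', d'⟩ h ⟨⟨⟨a1, b1⟩, a1', b1'⟩, ⟨c1, d1⟩, c1', d1'⟩ h1 e
    simp only [Prod.mk.injEq] at e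
    obtain ⟨rfl, rfl, rfl, rfl, rfl⟩ := e
    simp only [parT, Finset.mem_coe, Finset.mem_filter, Prod.mk.injEq] at h h1
    obtain ⟨-, e1, e2, e3⟩ := h
    obtain ⟨-, f1, f2, f3⟩ := h1
    have hc : c' = c1' := by linear_combination e3 - f3
    subst hc
    rw [e3] at e1 e2
    rw [e3] at f1 f2
    have : d = d1 := by linear_combination f2 - e2
    subst this
    have : d' = d1' := by linear_combination f1 - e1
    subst this
    rfl

theorem diag_T (A : Finset F) : (((A ×ˢ A) ×ˢ (A ×ˢ A)).filter fun w => w.1.1 = w.2.1).card ≤ A.card ^ 3 := by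
  have : A.card ^ 3 = (A ×ˢ A ×ˢ A).card := by simp only [Finset.card_product]; ring
  rw [this]
  apply Finset.card_le_card_of_injOn (fun x => (x.1.1, x.1.2, x.2.2))
  · rintro ⟨⟨a, b⟩, a', b'⟩ h
    simp only [Finset.mem_coe, Finset.mem_filter, Finset.mem_product] at h ⊢
    tauto
  · rintro ⟨⟨a, b⟩, a', b'⟩ h ⟨⟨c, d⟩, c', d'⟩ h1 e
    simp only [Finset.mem_coe, Finset.mem_filter, Prod.mk.injEq] at h h1 e ⊢
    obtain ⟨rfl, rfl, rfl⟩ := e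
    exact ⟨⟨rfl, rfl⟩, h.2.symm.trans h1.2, rfl⟩

theorem R3 (A : Finset F) (lam : F) (hl : lam ≠ 0) : ∃ H U : ℝ,
    (A.card : ℝ) ^ 2 * (facS A lam).card ≤ (A.card : ℝ) ^ 2 * ((A + A).card : ℝ) ^ 2 / Fintype.card F + H ∧
    H ^ 2 ≤ (A + A).card * ((A.card : ℝ) ^ 3 * (A + A).card + 4 * (A.card : ℝ) ^ 4 + U) ∧
    U ^ 2 ≤ (A.card : ℝ) ^ 5 * (2 * (Fintype.card F : ℝ) ^ 2 * ((A + A).card : ℝ) ^ 2) := by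
  set S := A + A with hS
  set h : F → ℝ := fun x => ∑ y ∈ A ×ˢ A, bal S (mob y.2 y.1 lam x) with hh
  have hP : ∀ w ∈ wordT A, (parT lam w).2.2 ≠ 0 := by
    intro w hw
    simp only [wordT, Finset.mem_filter] at hw
    exact sub_ne_zero.2 hw.2
  refine ⟨∑ x ∈ S, h x, ∑ w ∈ wordT A, balT S ((parT lam w).1, (parT lam w).2.1, -lam ^ 2 * ((parT lam w).2.2 ^ 2)⁻¹), ?_, ?_, ?_⟩
  · have h1 : A.card ^ 2 * (facS A lam).card ≤ ∑ x ∈ S, ∑ y ∈ A ×ˢ A, (if mob y.2 y.1 lam x ∈ S then 1 else 0) := by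
      rw [← Finset.sum_product', ← Finset.card_filter]
      have : A.card ^ 2 * (facS A lam).card = (facS A lam ×ˢ (A ×ˢ A)).card := by
        simp only [Finset.card_product]; ring
      rw [this]
      apply Finset.card_le_card_of_injOn (fun z => (z.2.1 + z.1, z.2))
      · rintro ⟨β, a, b⟩ hz
        simp only [Finset.mem_coe, Finset.mem_product, facS, Finset.mem_filter] at hz
        refine Finset.mem_coe.2 (Finset.mem_filter.2 ⟨Finset.mem_product.2 ⟨Finset.add_mem_add hz.2.1 hz.1.1, Finset.mem_product.2 hz.2⟩, ?_⟩)
        simp only [mob, add_sub_cancel_left]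
        exact Finset.add_mem_add hz.2.2 hz.1.2.2
      · rintro ⟨β, a, b⟩ - ⟨β', a', b'⟩ - e
        simp only [Prod.mk.injEq] at e
        obtain ⟨e1, rfl, rfl⟩ := e
        rw [add_left_cancel e1]
    have h2 : (A.card : ℝ) ^ 2 * (facS A lam).card ≤ ∑ x ∈ S, ∑ y ∈ A ×ˢ A, (if mob y.2 y.1 lam x ∈ S then (1:ℝ) else 0) := by
      exact_mod_cast h1
    refine h2.trans (le_of_eq ?_)
    have h3 : ∀ x, ∑ y ∈ A ×ˢ A, (if mob y.2 y.1 lam x ∈ S then (1:ℝ) else 0) = (A.card : ℝ) ^ 2 * (S.card / Fintype.card F) + h x := by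
      intro x
      simp only [hh, bal, Finset.sum_sub_distrib, Finset.sum_const, Finset.card_product, nsmul_eq_mul]
      push_cast; ring
    simp_rw [h3]
    rw [Finset.sum_add_distrib, Finset.sum_const, nsmul_eq_mul]
    ring
  · have c1 : (∑ x ∈ S, h x) ^ 2 ≤ S.card * ∑ x ∈ S, h x ^ 2 := sq_sum_le_card_mul_sum_sq
    refine c1.trans (mul_le_mul_of_nonneg_left ?_ (by positivity))
    have c2 : ∑ x ∈ S, h x ^ 2 ≤ ∑ x, h x ^ 2 := Finset.sum_le_sum_of_subset_of_nonneg (Finset.subset_univ _) fun x _ _ => sq_nonneg _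
    refine c2.trans ?_
    have c3 : ∑ x, h x ^ 2 = ∑ w ∈ (A ×ˢ A) ×ˢ (A ×ˢ A), ∑ x, bal S (mob w.1.2 w.1.1 lam x) * bal S (mob w.2.2 w.2.1 lam x) := by
      rw [Finset.sum_comm]
      refine Finset.sum_congr rfl fun x _ => ?_
      rw [sq, Finset.sum_mul_sum, ← Finset.sum_product']
    rw [c3, ← Finset.sum_filter_add_sum_filter_not _ (fun w : (F × F) × (F × F) => w.1.1 = w.2.1)]
    have d1 := Finset.sum_le_card_nsmul (((A ×ˢ A) ×ˢ (A ×ˢ A)).filter fun w => w.1.1 = w.2.1)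
      (fun w => ∑ x, bal S (mob w.1.2 w.1.1 lam x) * bal S (mob w.2.2 w.2.1 lam x)) (S.card : ℝ) (fun w _ => corr_same S _ _ _ _ lam hl)
    rw [nsmul_eq_mul] at d1
    have d2 : ((((A ×ˢ A) ×ˢ (A ×ˢ A)).filter fun w => w.1.1 = w.2.1).card : ℝ) * S.card ≤ (A.card : ℝ) ^ 3 * S.card := by
      have : ((((A ×ˢ A) ×ˢ (A ×ˢ A)).filter fun w => w.1.1 = w.2.1).card : ℝ) ≤ (A.card : ℝ) ^ 3 := by exact_mod_cast diag_T A
      gcongr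
    have d3 : ∑ w ∈ wordT A, ∑ x, bal S (mob w.1.2 w.1.1 lam x) * bal S (mob w.2.2 w.2.1 lam x) ≤
        ∑ w ∈ wordT A, (4 + balT S ((parT lam w).1, (parT lam w).2.1, -lam ^ 2 * ((parT lam w).2.2 ^ 2)⁻¹)) := by
      refine Finset.sum_le_sum fun w hw => ?_
      exact corr_diff S _ _ _ _ lam hl (hP w hw)
    rw [Finset.sum_add_distrib, Finset.sum_const, nsmul_eq_mul] at d3
    have d4 : ((wordT A).card : ℝ) ≤ (A.card : ℝ) ^ 4 := by
      have : (wordT A).card ≤ A.card ^ 4 := by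
        refine (Finset.card_filter_le _ _).trans (le_of_eq ?_)
        simp only [Finset.card_product]; ring
      exact_mod_cast this
    have d3' : ∑ w ∈ (((A ×ˢ A) ×ˢ (A ×ˢ A)).filter fun w => ¬ w.1.1 = w.2.1), ∑ x, bal S (mob w.1.2 w.1.1 lam x) * bal S (mob w.2.2 w.2.1 lam x) ≤ _ := d3
    linarith
  · refine (R2gen (wordT A) (parT lam) hP (-lam ^ 2) (neg_ne_zero.2 (pow_ne_zero 2 hl)) S).trans ?_
    have h2 : (coll (wordT A) (parT lam) : ℝ) ≤ (A.card : ℝ) ^ 5 := by exact_mod_cast coll_T A lam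
    gcongr

end Two

section Fin

theorem final_real (k u p y r E H U T V : ℝ) (hk : 1 ≤ k) (hu : 1 ≤ u) (hp : 0 < p) (hy0 : 0 ≤ y) (hy : y ≤ k ^ 4 * u ^ 24)
    (hr : r ≤ u ^ 24) (hE0 : 0 ≤ E)
    (hE : k ^ 8 ≤ u ^ 24 → E ≤ 10 ^ 7 * (k ^ 24 * u ^ 60 + k ^ 32 * u ^ 96 / p))
    (r1 : u ^ 48 * r ^ 3 ≤ u ^ 48 * (y * r) + 3 * (y ^ 2 * u ^ 48) + T)
    (r1' : T ^ 3 ≤ (y ^ 2 * u ^ 48) * (E * u ^ 48) * (8 * y ^ 6))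
    (r2 : u ^ 48 * r ^ 3 ≤ u ^ 48 * (y * r) + (y ^ 2 * u ^ 48) * (y ^ 2 / p) + V)
    (r2' : V ^ 2 ≤ (E * u ^ 48) * (2 * p ^ 2 * y ^ 2))
    (r3 : u ^ 48 * r ≤ u ^ 48 * y ^ 2 / p + H)
    (r3' : H ^ 2 ≤ y * (u ^ 72 * y + 4 * u ^ 96 + U))
    (r3'' : U ^ 2 ≤ u ^ 120 * (2 * p ^ 2 * y ^ 2)) :
    r ≤ 1000 * (k ^ 8 * u ^ 48 / p + k ^ 5 * u ^ 23) := by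
  by_contra hcon
  push Not at hcon
  have mono : ∀ a b c d : ℕ, a ≤ b → c ≤ d → k ^ a * u ^ c ≤ k ^ b * u ^ d := by
    intro a b c d h1 h2
    have := pow_le_pow_right₀ hk h1
    have := pow_le_pow_right₀ hu h2
    gcongr
  have hk0 : 0 < k := by linarith
  have hu0 : 0 < u := by linarith
  have hmain : 0 ≤ k ^ 8 * u ^ 48 / p := by positivity
  have hrlow : 1000 * (k ^ 5 * u ^ 23) ≤ r := by linarith
  have hrmain : 1000 * (k ^ 8 * u ^ 48 / p) ≤ r := by
    have : 0 ≤ k ^ 5 * u ^ 23 := by positivity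
    linarith
  have hr0 : 0 < r := lt_of_lt_of_le (by positivity) hrlow
  have hv0 : 0 < 1000 * (k ^ 5 * u ^ 23) := by positivity
  have ha : 1000 * k ^ 5 ≤ u := by
    have h1 : (1000 * k ^ 5) * u ^ 23 ≤ u * u ^ 23 := by
      calc (1000 * k ^ 5) * u ^ 23 = 1000 * (k ^ 5 * u ^ 23) := by ring
        _ ≤ r := hrlow
        _ ≤ u ^ 24 := hr
        _ = _ := by ring
    exact le_of_mul_le_mul_right h1 (by positivity)
  have hr2 : 10 ^ 6 * (k ^ 10 * u ^ 46) ≤ r ^ 2 := by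
    calc 10 ^ 6 * (k ^ 10 * u ^ 46) = (1000 * (k ^ 5 * u ^ 23)) ^ 2 := by ring
      _ ≤ r ^ 2 := by gcongr
  have hr3 : 10 ^ 9 * (k ^ 15 * u ^ 69) ≤ r ^ 3 := by
    calc 10 ^ 9 * (k ^ 15 * u ^ 69) = (1000 * (k ^ 5 * u ^ 23)) ^ 3 := by ring
      _ ≤ r ^ 3 := by gcongr
  have hy2 : y ^ 2 ≤ k ^ 8 * u ^ 48 := by
    calc y ^ 2 ≤ (k ^ 4 * u ^ 24) ^ 2 := by gcongr
      _ = _ := by ring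
  -- step b
  have hb : k ^ 2 * u ^ 34 ≤ p := by
    have b1 : y ^ 2 / p ≤ k ^ 8 * u ^ 48 / p := by gcongr
    have b2 : u ^ 48 * r / 2 ≤ H := by
      have e : u ^ 48 * y ^ 2 / p = u ^ 48 * (y ^ 2 / p) := by ring
      have : u ^ 48 * (y ^ 2 / p) ≤ u ^ 48 * (r / 2) := by
        refine mul_le_mul_of_nonneg_left ?_ (by positivity)
        linarith
      rw [e] at r3
      linarith
    have b3 : u ^ 96 * r ^ 2 / 4 ≤ H ^ 2 := by
      calc u ^ 96 * r ^ 2 / 4 = (u ^ 48 * r / 2) ^ 2 := by ring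
        _ ≤ H ^ 2 := by gcongr
    have b4 : U ≤ 2 * (p * (k ^ 4 * u ^ 84)) := by
      refine le_of_sq_le_sq ?_ (by positivity)
      refine r3''.trans ?_
      calc u ^ 120 * (2 * p ^ 2 * y ^ 2) ≤ u ^ 120 * (2 * p ^ 2 * (k ^ 8 * u ^ 48)) := by gcongr
        _ = 2 * (p ^ 2 * (k ^ 8 * u ^ 168)) := by ring
        _ ≤ 4 * (p ^ 2 * (k ^ 8 * u ^ 168)) := by gcongr; norm_num
        _ = _ := by ring
    have b5 : H ^ 2 ≤ 5 * (k ^ 8 * u ^ 120) + 2 * (p * (k ^ 8 * u ^ 108)) := by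
      have q1 : u ^ 72 * y + 4 * u ^ 96 + U ≤ u ^ 72 * (k ^ 4 * u ^ 24) + 4 * (k ^ 4 * u ^ 96) + 2 * (p * (k ^ 4 * u ^ 84)) := by
        have : u ^ 96 ≤ k ^ 4 * u ^ 96 := by simpa using mono 0 4 96 96 (by norm_num) le_rfl
        have : u ^ 72 * y ≤ u ^ 72 * (k ^ 4 * u ^ 24) := by gcongr
        linarith
      have q0 : 0 ≤ u ^ 72 * (k ^ 4 * u ^ 24) + 4 * (k ^ 4 * u ^ 96) + 2 * (p * (k ^ 4 * u ^ 84)) := by positivity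
      calc H ^ 2 ≤ y * (u ^ 72 * y + 4 * u ^ 96 + U) := r3'
        _ ≤ y * (u ^ 72 * (k ^ 4 * u ^ 24) + 4 * (k ^ 4 * u ^ 96) + 2 * (p * (k ^ 4 * u ^ 84))) := by gcongr
        _ ≤ (k ^ 4 * u ^ 24) * (u ^ 72 * (k ^ 4 * u ^ 24) + 4 * (k ^ 4 * u ^ 96) + 2 * (p * (k ^ 4 * u ^ 84))) := by gcongr
        _ = _ := by ring
    have b6 : 10 ^ 6 * (k ^ 10 * u ^ 142) ≤ u ^ 96 * r ^ 2 := by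
      calc 10 ^ 6 * (k ^ 10 * u ^ 142) = u ^ 96 * (10 ^ 6 * (k ^ 10 * u ^ 46)) := by ring
        _ ≤ _ := by gcongr
    have b7 := mono 8 10 120 142 (by norm_num) (by norm_num)
    have b8 : (k ^ 2 * u ^ 34) * (k ^ 8 * u ^ 108) ≤ p * (k ^ 8 * u ^ 108) := by
      have : (k ^ 2 * u ^ 34) * (k ^ 8 * u ^ 108) = k ^ 10 * u ^ 142 := by ring
      have : 0 ≤ k ^ 10 * u ^ 142 := by positivity
      linarith
    exact le_of_mul_le_mul_right b8 (by positivity)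
  -- step c
  have c1 : u ^ 48 * (y * r) ≤ u ^ 48 * r ^ 3 / 8 := by
    have : y ≤ r ^ 2 / 8 := by
      have := mono 4 10 24 46 (by norm_num) (by norm_num)
      have : 0 ≤ k ^ 10 * u ^ 46 := by positivity
      linarith
    calc u ^ 48 * (y * r) ≤ u ^ 48 * (r ^ 2 / 8 * r) := by gcongr
      _ = _ := by ring
  have c2 : 3 * (y ^ 2 * u ^ 48) ≤ u ^ 48 * r ^ 3 / 8 := by
    have : 3 * y ^ 2 ≤ r ^ 3 / 8 := by
      have := mono 8 15 48 69 (by norm_num) (by norm_num)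
      have : 0 ≤ k ^ 15 * u ^ 69 := by positivity
      linarith
    calc 3 * (y ^ 2 * u ^ 48) = u ^ 48 * (3 * y ^ 2) := by ring
      _ ≤ u ^ 48 * (r ^ 3 / 8) := by gcongr
      _ = _ := by ring
  have c3 : (y ^ 2 * u ^ 48) * (y ^ 2 / p) ≤ u ^ 48 * r ^ 3 / 8 := by
    have : y ^ 2 * (y ^ 2 / p) ≤ r ^ 3 / 8 := by
      have h1 : y ^ 2 / p ≤ k ^ 6 * u ^ 14 := by
        rw [div_le_iff₀ hp]
        calc y ^ 2 ≤ k ^ 8 * u ^ 48 := hy2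
          _ = k ^ 6 * u ^ 14 * (k ^ 2 * u ^ 34) := by ring
          _ ≤ _ := by gcongr
      have h2 : y ^ 2 * (y ^ 2 / p) ≤ (k ^ 8 * u ^ 48) * (k ^ 6 * u ^ 14) := by gcongr
      have h3 : (k ^ 8 * u ^ 48) * (k ^ 6 * u ^ 14) = k ^ 14 * u ^ 62 := by ring
      have := mono 14 15 62 69 (by norm_num) (by norm_num)
      have : 0 ≤ k ^ 15 * u ^ 69 := by positivity
      linarith
    calc (y ^ 2 * u ^ 48) * (y ^ 2 / p) = u ^ 48 * (y ^ 2 * (y ^ 2 / p)) := by ring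
      _ ≤ u ^ 48 * (r ^ 3 / 8) := by gcongr
      _ = _ := by ring
  have hpos : 0 < u ^ 48 * r ^ 3 := by positivity
  have dT : u ^ 48 * r ^ 3 / 2 ≤ T := by linarith
  have dV : u ^ 48 * r ^ 3 / 2 ≤ V := by linarith
  have hkN : k ^ 8 ≤ u ^ 24 := by
    have h1 : k ^ 5 ≤ u := by
      have : 0 ≤ k ^ 5 := by positivity
      linarith
    calc k ^ 8 ≤ k ^ 120 := pow_le_pow_right₀ hk (by norm_num)
      _ = (k ^ 5) ^ 24 := by ring
      _ ≤ u ^ 24 := by gcongr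
  have hE := hE hkN
  by_cases hcase : k ^ 8 * u ^ 36 ≤ p
  · have g1 : k ^ 32 * u ^ 96 / p ≤ k ^ 24 * u ^ 60 := by
      rw [div_le_iff₀ hp]
      calc k ^ 32 * u ^ 96 = k ^ 24 * u ^ 60 * (k ^ 8 * u ^ 36) := by ring
        _ ≤ _ := by gcongr
    have g2 : E ≤ 2 * 10 ^ 7 * (k ^ 24 * u ^ 60) := by linarith
    have g3 : (u ^ 48 * (10 ^ 9 * (k ^ 15 * u ^ 69)) / 2) ^ 3 ≤ T ^ 3 := by
      refine pow_le_pow_left₀ (by positivity) ?_ 3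
      refine le_trans ?_ dT
      gcongr
    have g4 : T ^ 3 ≤ 16 * 10 ^ 7 * (k ^ 56 * u ^ 348) := by
      refine r1'.trans ?_
      calc (y ^ 2 * u ^ 48) * (E * u ^ 48) * (8 * y ^ 6) = 8 * (y ^ 2) ^ 4 * E * u ^ 96 := by ring
        _ ≤ 8 * (k ^ 8 * u ^ 48) ^ 4 * (2 * 10 ^ 7 * (k ^ 24 * u ^ 60)) * u ^ 96 := by gcongr
        _ = _ := by ring
    have g5 : (10 ^ 27 / 8) * (k ^ 45 * u ^ 348) * u ^ 3 ≤ 16 * 10 ^ 7 * (k ^ 56 * u ^ 348) := by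
      refine le_trans (le_of_eq ?_) (g3.trans g4)
      ring
    have g6 : k ^ 15 ≤ u ^ 3 := by
      have h1 : k ^ 5 ≤ u := by
        have : 0 ≤ k ^ 5 := by positivity
        linarith
      calc k ^ 15 = (k ^ 5) ^ 3 := by ring
        _ ≤ _ := by gcongr
    have g7 : (10 ^ 27 / 8) * (k ^ 45 * u ^ 348) * k ^ 15 ≤ (10 ^ 27 / 8) * (k ^ 45 * u ^ 348) * u ^ 3 := by gcongr
    have g8 := mono 56 60 348 348 (by norm_num) le_rfl
    have g9 : (10 ^ 27 / 8) * (k ^ 45 * u ^ 348) * k ^ 15 = (10 ^ 27 / 8) * (k ^ 60 * u ^ 348) := by ring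
    have g10 : 0 < k ^ 60 * u ^ 348 := by positivity
    rw [g9] at g7
    linarith
  · push Not at hcase
    have g1 : k ^ 24 * u ^ 60 ≤ k ^ 32 * u ^ 96 / p := by
      rw [le_div_iff₀ hp]
      calc k ^ 24 * u ^ 60 * p ≤ k ^ 24 * u ^ 60 * (k ^ 8 * u ^ 36) := by gcongr
        _ = _ := by ring
    have g2 : E ≤ 2 * 10 ^ 7 * (k ^ 32 * u ^ 96 / p) := by linarith
    have g3 : (u ^ 48 * (10 ^ 9 * (k ^ 15 * u ^ 69)) / 2) ^ 2 ≤ V ^ 2 := by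
      refine pow_le_pow_left₀ (by positivity) ?_ 2
      refine le_trans ?_ dV
      gcongr
    have g4 : V ^ 2 ≤ 4 * 10 ^ 7 * (k ^ 48 * u ^ 228) := by
      refine r2'.trans ?_
      calc (E * u ^ 48) * (2 * p ^ 2 * y ^ 2) ≤ ((2 * 10 ^ 7 * (k ^ 32 * u ^ 96 / p)) * u ^ 48) * (2 * p ^ 2 * (k ^ 8 * u ^ 48)) := by gcongr
        _ = 4 * 10 ^ 7 * (k ^ 40 * u ^ 192) * p := by field_simp; ring
        _ ≤ 4 * 10 ^ 7 * (k ^ 40 * u ^ 192) * (k ^ 8 * u ^ 36) := by gcongr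
        _ = _ := by ring
    have g5 : (10 ^ 18 / 4) * (k ^ 30 * u ^ 228) * u ^ 6 ≤ 4 * 10 ^ 7 * (k ^ 48 * u ^ 228) := by
      refine le_trans (le_of_eq ?_) (g3.trans g4)
      ring
    have g6 : k ^ 30 ≤ u ^ 6 := by
      have h1 : k ^ 5 ≤ u := by
        have : 0 ≤ k ^ 5 := by positivity
        linarith
      calc k ^ 30 = (k ^ 5) ^ 6 := by ring
        _ ≤ _ := by gcongr
    have g7 : (10 ^ 18 / 4) * (k ^ 30 * u ^ 228) * k ^ 30 ≤ (10 ^ 18 / 4) * (k ^ 30 * u ^ 228) * u ^ 6 := by gcongr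
    have g8 := mono 48 60 228 228 (by norm_num) le_rfl
    have g9 : (10 ^ 18 / 4) * (k ^ 30 * u ^ 228) * k ^ 30 = (10 ^ 18 / 4) * (k ^ 60 * u ^ 228) := by ring
    have g10 : 0 < k ^ 60 * u ^ 228 := by positivity
    rw [g9] at g7
    linarith

end Fin


theorem mulRep_le (p : ℕ) [Fact p.Prime] (A : Finset (ZMod p)) (lam : ZMod p) (hl : lam ≠ 0) :
    mulRep p A lam ≤ (facS A lam).card := by
  unfold mulRep
  apply Finset.card_le_card_of_injOn (fun t => t.1)
  · rintro ⟨a, b⟩ h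
    simp only [Finset.mem_coe, Finset.mem_filter, Finset.mem_product, facS] at h ⊢
    have ha : a ≠ 0 := by
      rintro rfl; rw [zero_mul] at h; exact hl h.2.symm
    refine ⟨h.1.1, ha, ?_⟩
    rw [← h.2, mul_comm a b, mul_assoc, mul_inv_cancel₀ ha, mul_one]
    exact h.1.2
  · rintro ⟨a, b⟩ h ⟨a', b'⟩ h' e
    simp only [Finset.mem_coe, Finset.mem_filter] at h h' e
    subst e
    have ha : a ≠ 0 := by
      rintro rfl; rw [zero_mul] at h; exact hl h.2.symm
    rw [mul_left_cancel₀ ha (h.2.trans h'.2.symm)]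

theorem core_bound (p : ℕ) [Fact p.Prime] (K : ℝ) (hK1 : 1 ≤ K) (A : Finset (ZMod p)) (hK : ((A + A).card : ℝ) ≤ K * A.card)
    (lam : ZMod p) (hl : lam ≠ 0) (hA : A.Nonempty) :
    ((facS A lam).card : ℝ) ≤ 1000 * (K ^ 2 * (A.card : ℝ) ^ 2 / p + K ^ ((5 : ℝ) / 4) * (A.card : ℝ) ^ ((23 : ℝ) / 24)) := by
  have hp0 : (0:ℝ) < p := by exact_mod_cast (Fact.out : p.Prime).pos
  have hN1 : (1:ℝ) ≤ A.card := by exact_mod_cast hA.card_pos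
  have hN0 : (0:ℝ) ≤ A.card := by linarith
  have hK0 : 0 ≤ K := by linarith
  obtain ⟨T, a1, a2⟩ := R1 A lam hl
  obtain ⟨V, b1, b2⟩ := R2 A lam hl
  obtain ⟨H, U, c1, c2, c3⟩ := R3 A lam hl
  have hE := energy_bound p A K hK1 hK hA
  rw [ZMod.card] at b1 b2 c1 c3
  have hr : ((facS A lam).card : ℝ) ≤ A.card := by exact_mod_cast Finset.card_filter_le _ _
  set k : ℝ := K ^ ((1:ℝ)/4) with hk
  set u : ℝ := (A.card : ℝ) ^ ((1:ℝ)/24) with hu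
  have k1 : 1 ≤ k := Real.one_le_rpow hK1 (by norm_num)
  have u1 : 1 ≤ u := Real.one_le_rpow hN1 (by norm_num)
  have k4 : K = k ^ 4 := by
    rw [hk, ← Real.rpow_natCast, ← Real.rpow_mul hK0]; norm_num
  have u24 : (A.card : ℝ) = u ^ 24 := by
    rw [hu, ← Real.rpow_natCast, ← Real.rpow_mul hN0]; norm_num
  have k5 : K ^ ((5:ℝ)/4) = k ^ 5 := by
    rw [hk, ← Real.rpow_natCast, ← Real.rpow_mul hK0]; norm_num
  have u23 : (A.card : ℝ) ^ ((23:ℝ)/24) = u ^ 23 := by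
    rw [hu, ← Real.rpow_natCast, ← Real.rpow_mul hN0]; norm_num
  clear_value k u
  have hs : Real.sqrt A.card = u ^ 12 := by
    rw [u24, show u ^ 24 = (u ^ 12) ^ 2 by ring, Real.sqrt_sq (pow_nonneg (by linarith) 12)]
  rw [k5, u23]
  rw [hs] at hE
  rw [k4] at hK hE ⊢
  rw [u24] at hK hE hr a1 a2 b1 b2 c1 c2 c3 ⊢
  have := final_real k u p (A + A).card (facS A lam).card (mulEn (A + A)) H U T V k1 u1 hp0 (Nat.cast_nonneg _) hK hr (Nat.cast_nonneg _)
    (by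
      intro h
      refine (hE (by rw [← pow_mul]; exact h)).trans (le_of_eq ?_)
      ring)
    (by convert a1 using 1 <;> ring) (by convert a2 using 1; ring) (by convert b1 using 1 <;> ring) (by convert b2 using 1; ring)
    (by convert c1 using 1 <;> ring) (by convert c2 using 1; ring) (by convert c3 using 1; ring)
  convert this using 1
  ring

theorem stmt3 :
    ∃ C c : ℝ, 1 ≤ C ∧ 1 ≤ c ∧
      ∀ (p : ℕ), p.Prime → Odd p →
        ∀ K : ℝ, 1 ≤ K →
          ∀ A : Finset (ZMod p), ((A + A).card : ℝ) ≤ K * A.card →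
            ∀ lam : ZMod p, lam ≠ 0 →
              (mulRep p A lam : ℝ) ≤
                C * Real.log p ^ c *
                  (K ^ 2 * (A.card : ℝ) ^ 2 / p +
                    K ^ ((5 : ℝ) / 4) * (A.card : ℝ) ^ ((23 : ℝ) / 24)) := by
  refine ⟨1000, 1, by norm_num, le_rfl, ?_⟩
  intro p hp hodd K hK1 A hK lam hl
  haveI : Fact p.Prime := ⟨hp⟩
  have hp3 : 3 ≤ p := by
    have := hp.two_le
    rcases hodd with ⟨m, hm⟩
    omega
  have hlog : 1 ≤ Real.log p := by
    rw [Real.le_log_iff_exp_le (by exact_mod_cast hp.pos)]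
    have h3 : (3:ℝ) ≤ p := by exact_mod_cast hp3
    linarith [Real.exp_one_lt_d9]
  have hX : 0 ≤ K ^ 2 * (A.card : ℝ) ^ 2 / p + K ^ ((5 : ℝ) / 4) * (A.card : ℝ) ^ ((23 : ℝ) / 24) := by positivity
  rw [Real.rpow_one]
  rcases A.eq_empty_or_nonempty with rfl | hA
  · have : mulRep p ∅ lam = 0 := by simp [mulRep]
    rw [this, Nat.cast_zero]
    positivity
  · have h1 : (mulRep p A lam : ℝ) ≤ (facS A lam).card := by exact_mod_cast mulRep_le p A lam hl
    refine h1.trans ((core_bound p K hK1 A hK lam hl hA).trans ?_)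
    refine mul_le_mul_of_nonneg_right ?_ hX
    linarith
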